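/- arXiv:2403.13775 — 2 statements merged into one kernel-verified Lean document; each statement's English description precedes it below -/
import Mathlib

section
/- Let F be an algebraically closed field of characteristic different from 2 and G an abelian group. (1) For every elementary 2-subgroup T of G of rank 2m, every order-2 element t ∈ G∖T, and every quadratic form τ: T → F whose polar form β is a nondegenerate alternating bicharacter, D_inv(T,β,τ)^ex_t is a G-graded graded-division algebra with involution that is simple as an algebra with involution but whose underlying algebra is not simple. (2) Conversely, every G-graded graded-division algebra with involution (D,φ₀,Γ) that is simple as an algebra with involution and whose underlying algebra D is not simple is isomorphic to some D_inv(T,β,τ)^ex_t of this form. (3) D_inv(T₁,β₁,τ₁)^ex_{t₁} ≅ D_inv(T₂,β₂,τ₂)^ex_{t₂} if and only if T₁⟨t₁⟩ = T₂⟨t₂⟩, t₁ = t₂, β₁^{[t₁]} = β₂^{[t₂]} and τ₁^{[t₁]} = τ₂^{[t₂]}. -/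
universe u v w

section defs

variable (F : Type u) [Field F] (G : Type v) [CommGroup G]

/-- The exchange involution `(x,y) ↦ (y,x)` on `D ⊕ D^op`. -/
def exInvG (D : Type w) [Ring D] [Algebra F D] : (D × Dᵐᵒᵖ) →ₗ[F] (D × Dᵐᵒᵖ) :=
  (((MulOpposite.opLinearEquiv F).symm.toLinearMap).comp (LinearMap.snd F D Dᵐᵒᵖ)).prod
    (((MulOpposite.opLinearEquiv F).toLinearMap).comp (LinearMap.fst F D Dᵐᵒᵖ))

/-- The exchange grading `Γ^ex_t` on `D ⊕ D^op` twisted by an order 2 element `t`: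
for `x ∈ D_h`, `(x, φ(x))` has degree `h` and `(x, −φ(x))` has degree `ht`; thus the
homogeneous component of degree `h` is `{(x+y, op (φ₀ x − φ₀ y)) : x ∈ D_h, y ∈ D_{ht}}`. -/
def exGrT {D : Type w} [Ring D] [Algebra F D] (φ₀ : D →ₗ[F] D) (Dgr : G → Submodule F D)
    (t : G) (h : G) : Submodule F (D × Dᵐᵒᵖ) :=
  Submodule.map
    ((LinearMap.fst F D D + LinearMap.snd F D D).prod
      ((MulOpposite.opLinearEquiv F).toLinearMap.comp
        (φ₀.comp (LinearMap.fst F D D) - φ₀.comp (LinearMap.snd F D D))))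
    ((Dgr h).prod (Dgr (h * t)))

/-- The projection of `T'⟨t⟩` onto `T'` along `t`. -/
noncomputable def projT (T' : Subgroup G) (t s : G) : G :=
  @ite _ (s ∈ T') (Classical.dec _) s (s * t)

/-- `τ^[t]` : `τ^[t](u t^k) = τ(u)·(−1)^k` for `u ∈ T'`, `k ∈ {0,1}`. -/
noncomputable def tauExt (T' : Subgroup G) (t : G) (τ : G → F) (s : G) : F :=
  @ite _ (s ∈ T') (Classical.dec _) (τ s) (-(τ (s * t)))

/-- `β^[t]` : `β^[t](u t^{k₁}, v t^{k₂}) = β(u,v)` for `u,v ∈ T'`. -/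
noncomputable def betaExt (T' : Subgroup G) (t : G) (β : G → G → F) (s s' : G) : F :=
  β (projT G T' t s) (projT G T' t s')

/-- `τ` is a quadratic form on `T` with values in `{±1}` whose polar form `β` is a
nondegenerate alternating bicharacter on `T`. -/
def QuadData (T : Subgroup G) (β : G → G → F) (τ : G → F) : Prop :=
  (∀ u ∈ T, τ u = 1 ∨ τ u = -1) ∧
  (∀ u ∈ T, ∀ v ∈ T, β u v = τ (u * v) * τ u * τ v) ∧
  (∀ u ∈ T, ∀ v ∈ T, ∀ w ∈ T, β (u * v) w = β u w * β v w) ∧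
  (∀ u ∈ T, ∀ v ∈ T, ∀ w ∈ T, β u (v * w) = β u v * β u w) ∧
  (∀ u ∈ T, β u u = 1) ∧
  (∀ u ∈ T, (∀ v ∈ T, β u v = 1) → u = 1)

/-- `(D, φ₀, Dgr, X)` is (a realization of) `D_inv(T,β,τ)`: the standard realization
`D(T,β)` — a `G`-graded division algebra with support `T`, one-dimensional components spanned
by the `X t` with commutation relations given by `β` — equipped with the involution
`d ↦ τ(s)·d` for `d` of degree `s`. -/
def IsDinv [DecidableEq G] (D : Type w) [Ring D] [Algebra F D] (φ₀ : D →ₗ[F] D)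
    (Dgr : G → Submodule F D) (X : G → D) (T : Subgroup G) (β : G → G → F) (τ : G → F) :
    Prop :=
  DirectSum.IsInternal Dgr ∧ (1 : D) ∈ Dgr 1 ∧
  (∀ g h : G, ∀ x ∈ Dgr g, ∀ y ∈ Dgr h, x * y ∈ Dgr (g * h)) ∧
  FiniteDimensional F D ∧
  (∀ g : G, ∀ x ∈ Dgr g, x ≠ 0 → IsUnit x) ∧
  (∀ g : G, Dgr g ≠ ⊥ ↔ g ∈ T) ∧
  (∀ t' ∈ T, X t' ≠ 0 ∧ X t' ∈ Dgr t' ∧ ∀ x ∈ Dgr t', ∃ c : F, x = c • X t') ∧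
  (∀ t₁ ∈ T, ∀ t₂ ∈ T, X t₁ * X t₂ = β t₁ t₂ • (X t₂ * X t₁)) ∧
  (∀ a, φ₀ (φ₀ a) = a) ∧ (∀ a b, φ₀ (a * b) = φ₀ b * φ₀ a) ∧
  (∀ t' ∈ T, ∀ x ∈ Dgr t', φ₀ x = τ t' • x)

end defs

/-- Packaged G-graded algebra with involution and a chosen family of homogeneous elements
(a realization of some `D_inv(T,β,τ)`). -/
structure DinvData (F : Type u) [Field F] (G : Type v) [CommGroup G] :
    Type (max u v (w + 1)) where
  carrier : Type w
  [ring : Ring carrier]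
  [alg : Algebra F carrier]
  inv : carrier →ₗ[F] carrier
  gr : G → Submodule F carrier
  X : G → carrier

attribute [instance] DinvData.ring DinvData.alg

namespace GradedDivInv

variable {F : Type u} [Field F] {G : Type v} [CommGroup G]

/-- A finite-dimensional `G`-graded graded-division algebra `A` with support `T` and
one-dimensional homogeneous components, together with an involution `φ` which acts on the
component of degree `s` as the scalar `τ s`. -/
structure IsGradedDivInv [DecidableEq G] {A : Type*} [Ring A] [Algebra F A]
    (φ : A →ₗ[F] A) (Γ : G → Submodule F A) (T : Subgroup G) (τ : G → F) : Prop where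
  internal : DirectSum.IsInternal Γ
  one_mem : (1 : A) ∈ Γ 1
  mul_mem : ∀ {g h : G} {x y : A}, x ∈ Γ g → y ∈ Γ h → x * y ∈ Γ (g * h)
  finite : FiniteDimensional F A
  isUnit : ∀ {g : G} {x : A}, x ∈ Γ g → x ≠ 0 → IsUnit x
  ne_bot_iff : ∀ g : G, Γ g ≠ ⊥ ↔ g ∈ T
  exists_smul : ∀ {g : G} {x y : A}, x ∈ Γ g → y ∈ Γ g → x ≠ 0 → ∃ c : F, y = c • x
  inv_inv : ∀ a, φ (φ a) = a
  inv_mul : ∀ a b, φ (a * b) = φ b * φ a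
  inv_apply : ∀ {g : G} {x : A}, g ∈ T → x ∈ Γ g → φ x = τ g • x

/-- The polar form of `τ`. -/
def polar (τ : G → F) (g h : G) : F := τ (g * h) * τ g * τ h

theorem polar_comm (τ : G → F) (u v : G) : polar τ u v = polar τ v u := by
  simp only [polar, mul_comm u v]
  ring

variable [DecidableEq G]

theorem _root_.IsDinv.isGradedDivInv {D : Type*} [Ring D] [Algebra F D] {φ₀ : D →ₗ[F] D}
    {Dgr : G → Submodule F D} {X : G → D} {T : Subgroup G} {β : G → G → F} {τ : G → F}
    (h : IsDinv F G D φ₀ Dgr X T β τ) : IsGradedDivInv φ₀ Dgr T τ := by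
  obtain ⟨h1, h2, h3, h4, h5, h6, h7, -, h9, h10, h11⟩ := h
  refine ⟨h1, h2, fun hx hy => h3 _ _ _ hx _ hy, h4, fun hx hx0 => h5 _ _ hx hx0, h6, ?_, h9,
    h10, fun hg hx => h11 _ hg _ hx⟩
  intro g x y hx hy hx0
  have hg : g ∈ T := (h6 g).1 fun hb => hx0 (by simpa [hb] using hx)
  obtain ⟨a, rfl⟩ := (h7 g hg).2.2 x hx
  obtain ⟨b, rfl⟩ := (h7 g hg).2.2 y hy
  have ha : a ≠ 0 := fun h => hx0 (by simp [h])
  exact ⟨b * a⁻¹, by rw [smul_smul, mul_assoc, inv_mul_cancel₀ ha, mul_one]⟩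

namespace IsGradedDivInv

section basic

variable {A : Type*} [Ring A] [Algebra F A] {φ : A →ₗ[F] A} {Γ : G → Submodule F A}
  {T : Subgroup G} {τ : G → F}

theorem exists_mem_ne_zero (h : IsGradedDivInv φ Γ T τ) {g : G} (hg : g ∈ T) :
    ∃ x ∈ Γ g, x ≠ 0 :=
  (Submodule.ne_bot_iff _).1 ((h.ne_bot_iff g).2 hg)

theorem mem_of_ne_zero (h : IsGradedDivInv φ Γ T τ) {g : G} {x : A} (hx : x ∈ Γ g)
    (hx0 : x ≠ 0) : g ∈ T :=
  (h.ne_bot_iff g).1 fun hb => hx0 (by simpa [hb] using hx)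

theorem eq_zero_of_notMem (h : IsGradedDivInv φ Γ T τ) {g : G} (hg : g ∉ T) {x : A}
    (hx : x ∈ Γ g) : x = 0 := by
  by_contra hx0
  exact hg (h.mem_of_ne_zero hx hx0)

theorem nontrivial (h : IsGradedDivInv φ Γ T τ) : Nontrivial A := by
  obtain ⟨x, -, hx⟩ := h.exists_mem_ne_zero T.one_mem
  exact ⟨⟨x, 0, hx⟩⟩

theorem tau_mul_self (h : IsGradedDivInv φ Γ T τ) {g : G} (hg : g ∈ T) : τ g * τ g = 1 := by
  obtain ⟨x, hx, hx0⟩ := h.exists_mem_ne_zero hg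
  have h1 := h.inv_inv x
  rw [h.inv_apply hg hx, map_smul, h.inv_apply hg hx, smul_smul] at h1
  exact smul_left_injective F hx0 (by simpa using h1)

theorem tau_eq (h : IsGradedDivInv φ Γ T τ) {g : G} (hg : g ∈ T) : τ g = 1 ∨ τ g = -1 :=
  mul_self_eq_one_iff.1 (h.tau_mul_self hg)

theorem tau_one (h : IsGradedDivInv φ Γ T τ) : τ 1 = 1 := by
  have := h.nontrivial
  have h1 : φ 1 = 1 := by
    have := h.inv_mul (φ 1) 1
    rw [mul_one, h.inv_inv, mul_one] at this
    exact this.symm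
  rw [h.inv_apply T.one_mem h.one_mem] at h1
  exact smul_left_injective F (one_ne_zero (α := A)) (by simpa using h1)

theorem mul_comm_smul (h : IsGradedDivInv φ Γ T τ) {u v : G} (hu : u ∈ T) (hv : v ∈ T)
    {x y : A} (hx : x ∈ Γ u) (hy : y ∈ Γ v) : x * y = polar τ u v • (y * x) := by
  have h1 := h.inv_mul x y
  rw [h.inv_apply hu hx, h.inv_apply hv hy, h.inv_apply (T.mul_mem hu hv) (h.mul_mem hx hy),
    smul_mul_smul_comm] at h1
  have h2 := congrArg (τ (u * v) • ·) h1
  simp only [smul_smul, h.tau_mul_self (T.mul_mem hu hv), one_smul] at h2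
  rw [h2, polar]
  congr 1
  ring

theorem mul_ne_zero (h : IsGradedDivInv φ Γ T τ) {u : G} {x y : A} (hx : x ∈ Γ u)
    (hx0 : x ≠ 0) (hy0 : y ≠ 0) : x * y ≠ 0 := fun h0 =>
  hy0 ((h.isUnit hx hx0).mul_right_eq_zero.1 h0)

theorem polar_mul_left (h : IsGradedDivInv φ Γ T τ) {u v w : G} (hu : u ∈ T) (hv : v ∈ T)
    (hw : w ∈ T) : polar τ (u * v) w = polar τ u w * polar τ v w := by
  obtain ⟨x, hx, hx0⟩ := h.exists_mem_ne_zero hu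
  obtain ⟨y, hy, hy0⟩ := h.exists_mem_ne_zero hv
  obtain ⟨z, hz, hz0⟩ := h.exists_mem_ne_zero hw
  have h1 := h.mul_comm_smul (T.mul_mem hu hv) hw (h.mul_mem hx hy) hz
  rw [mul_assoc, h.mul_comm_smul hv hw hy hz, mul_smul_comm, ← mul_assoc,
    h.mul_comm_smul hu hw hx hz, smul_mul_assoc, smul_smul, mul_assoc] at h1
  have h2 := smul_left_injective F
    (h.mul_ne_zero hz hz0 (h.mul_ne_zero hx hx0 hy0)) h1
  rw [← h2, mul_comm]

theorem polar_mul_right (h : IsGradedDivInv φ Γ T τ) {u v w : G} (hu : u ∈ T) (hv : v ∈ T)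
    (hw : w ∈ T) : polar τ u (v * w) = polar τ u v * polar τ u w := by
  rw [polar_comm, h.polar_mul_left hv hw hu, polar_comm τ v, polar_comm τ w]

theorem polar_mul_self (h : IsGradedDivInv φ Γ T τ) {u v : G} (hu : u ∈ T) (hv : v ∈ T) :
    polar τ u v * polar τ u v = 1 := by
  have h1 := h.tau_mul_self hu
  have h2 := h.tau_mul_self hv
  have h3 := h.tau_mul_self (T.mul_mem hu hv)
  simp only [polar]
  linear_combination (τ u * τ u * τ v * τ v) * h3 + (τ v * τ v) * h1 + h2

theorem polar_self (h : IsGradedDivInv φ Γ T τ) {u : G} (hu : u ∈ T) : polar τ u u = 1 := by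
  obtain ⟨x, hx, hx0⟩ := h.exists_mem_ne_zero hu
  have h1 := h.mul_comm_smul hu hu hx hx
  exact smul_left_injective F (h.mul_ne_zero hx hx0 hx0) (by simpa using h1.symm)

theorem quadData (h : IsGradedDivInv φ Γ T τ)
    (hn : ∀ u ∈ T, (∀ v ∈ T, polar τ u v = 1) → u = 1) : QuadData F G T (polar τ) τ :=
  ⟨fun _ hu => h.tau_eq hu, fun _ _ _ _ => rfl,
    fun _ hu _ hv _ hw => h.polar_mul_left hu hv hw,
    fun _ hu _ hv _ hw => h.polar_mul_right hu hv hw, fun _ hu => h.polar_self hu, hn⟩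

/-- A choice of nonzero homogeneous elements, one in each component of the support, is a
basis. -/
theorem exists_basis (h : IsGradedDivInv φ Γ T τ) :
    ∃ b : Module.Basis T F A, ∀ s : T, b s ∈ Γ s := by
  choose X hX hX0 using fun s : T => h.exists_mem_ne_zero s.2
  have hli : LinearIndependent F X :=
    (h.internal.submodule_iSupIndep.comp Subtype.val_injective).linearIndependent
      (fun s : T => Γ s) hX hX0
  have hsp : ⊤ ≤ Submodule.span F (Set.range X) := by
    rw [← h.internal.submodule_iSup_eq_top]
    refine iSup_le fun g x hx => ?_
    by_cases hg : g ∈ T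
    · obtain ⟨c, rfl⟩ := h.exists_smul (hX ⟨g, hg⟩) hx (hX0 _)
      exact Submodule.smul_mem _ _ (Submodule.subset_span ⟨_, rfl⟩)
    · simp [h.eq_zero_of_notMem hg hx]
  exact ⟨Module.Basis.mk hli hsp, fun s => by simpa using hX s⟩

/-- If the polar form is nondegenerate then the underlying algebra has no proper two-sided
ideals. -/
theorem eq_bot_or_eq_top (h : IsGradedDivInv φ Γ T τ)
    (hn : ∀ u ∈ T, (∀ v ∈ T, polar τ u v = 1) → u = 1) (I : Submodule F A)
    (hI : ∀ a : A, ∀ x ∈ I, a * x ∈ I ∧ x * a ∈ I) : I = ⊥ ∨ I = ⊤ := by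
  classical
  obtain ⟨b, hb⟩ := h.exists_basis
  have key : ∀ n : ℕ, ∀ x ∈ I, x ≠ 0 → (b.repr x).support.card = n → I = ⊤ := by
    intro n
    induction n using Nat.strong_induction_on with
    | _ n ih =>
    intro x hx hx0 hcard
    have hr0 : b.repr x ≠ 0 := by simpa using hx0
    obtain ⟨s, hs⟩ := Finsupp.support_nonempty_iff.2 hr0
    by_cases hex : ∃ s' ∈ (b.repr x).support, s' ≠ s
    · obtain ⟨s', hs', hne⟩ := hex
      obtain ⟨u, hu, hpu⟩ : ∃ u ∈ T, polar τ u s ≠ polar τ u s' := by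
        by_contra! hcon
        have h1 := hn (s * (s' : G)⁻¹) (T.mul_mem s.2 (T.inv_mem s'.2)) fun v hv => by
          have h2 := h.polar_mul_left (T.mul_mem s.2 (T.inv_mem s'.2)) s'.2 hv
          rw [inv_mul_cancel_right, polar_comm τ s, polar_comm τ s', hcon v hv] at h2
          have h3 := h.polar_mul_self hv s'.2
          have h4 : polar τ v s' ≠ 0 := fun h0 => by simp [h0] at h3
          exact mul_right_cancel₀ h4 (by rw [← h2, one_mul])
        exact hne (Subtype.ext (mul_inv_eq_one.1 h1).symm)
      obtain ⟨y, hy⟩ := h.isUnit (hb ⟨u, hu⟩) (b.ne_zero _)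
      have hconj : ∀ (r : T) (z : A), b.repr (y * z * ↑y⁻¹) r = polar τ u r * b.repr z r := by
        intro r
        let f : A →ₗ[F] F := (b.coord r) ∘ₗ (LinearMap.mulRight F (↑y⁻¹ : A)) ∘ₗ
          (LinearMap.mulLeft F (y : A))
        let g : A →ₗ[F] F := polar τ u r • b.coord r
        have hfg : f = g := b.ext fun q => by
          have h1 : (y : A) * b q * ↑y⁻¹ = polar τ u q • b q := by
            rw [hy, h.mul_comm_smul hu q.2 (hb ⟨u, hu⟩) (hb q), ← hy, smul_mul_assoc,
              Units.mul_inv_cancel_right]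
          simp only [f, g, LinearMap.comp_apply, LinearMap.mulLeft_apply,
            LinearMap.mulRight_apply, h1, map_smul, LinearMap.smul_apply, smul_eq_mul,
            Module.Basis.coord_apply, Module.Basis.repr_self]
          by_cases hqr : q = r
          · rw [hqr]
          · simp [hqr]
        exact fun z => LinearMap.congr_fun hfg z
      have hw : ∀ r : T, b.repr (y * x * ↑y⁻¹ - polar τ u s • x) r
          = (polar τ u r - polar τ u s) * b.repr x r := fun r => by
        rw [map_sub, map_smul, Finsupp.sub_apply, hconj, Finsupp.smul_apply, smul_eq_mul, sub_mul]
      refine ih _ ?_ (y * x * ↑y⁻¹ - polar τ u s • x)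
        (I.sub_mem (hI _ _ (hI _ _ hx).1).2 (I.smul_mem _ hx)) ?_ rfl
      · rw [← hcard]
        refine Finset.card_lt_card ⟨fun r hr => ?_, fun hsub => ?_⟩
        · rw [Finsupp.mem_support_iff, hw] at hr
          exact Finsupp.mem_support_iff.2 (right_ne_zero_of_mul hr)
        · have := hsub hs
          rw [Finsupp.mem_support_iff, hw] at this
          simp at this
      · intro h0
        have := hw s'
        rw [h0, map_zero, Finsupp.zero_apply, eq_comm, mul_eq_zero, sub_eq_zero] at this
        exact this.elim (fun h => hpu h.symm) (Finsupp.mem_support_iff.1 hs')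
    · push Not at hex
      have hx1 : x = b.repr x s • b s := by
        conv_lhs => rw [← b.linearCombination_repr x]
        rw [Finsupp.linearCombination_apply, Finsupp.sum,
          Finset.eq_singleton_iff_unique_mem.2 ⟨hs, hex⟩, Finset.sum_singleton]
      obtain ⟨y, hy⟩ := h.isUnit ((Γ s).smul_mem _ (hb s)) (hx1 ▸ hx0)
      rw [← hy] at hx1
      refine eq_top_iff.2 fun a _ => ?_
      have := (hI (a * ↑y⁻¹) x hx).1
      rwa [hx1, Units.inv_mul_cancel_right] at this
  by_cases hbot : I = ⊥
  · exact Or.inl hbot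
  · obtain ⟨x, hx, hx0⟩ := (Submodule.ne_bot_iff _).1 hbot
    exact Or.inr (key _ x hx hx0 rfl)

/-- If the polar form is nondegenerate then the support has square order. -/
theorem natCard_eq_sq [IsAlgClosed F] (h : IsGradedDivInv φ Γ T τ)
    (hn : ∀ u ∈ T, (∀ v ∈ T, polar τ u v = 1) → u = 1) : ∃ n : ℕ, Nat.card T = n * n := by
  have := h.nontrivial
  have := h.finite
  have hsimple : IsSimpleRing A := by
    refine ⟨⟨fun J => ?_⟩⟩
    let I : Submodule F A :=
      { carrier := J
        add_mem' := J.add_mem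
        zero_mem' := J.zero_mem
        smul_mem' := fun c x hx => by
          rw [Algebra.smul_def]
          exact J.mul_mem_left _ _ hx }
    rcases h.eq_bot_or_eq_top hn I fun a x hx => ⟨J.mul_mem_left a x hx, J.mul_mem_right x a hx⟩
      with hI | hI
    · left
      refine TwoSidedIdeal.ext fun x => ?_
      rw [TwoSidedIdeal.mem_bot]
      exact (iff_of_eq (congrArg (x ∈ ·) hI)).trans (Submodule.mem_bot F)
    · right
      refine TwoSidedIdeal.ext fun x => ?_
      exact (iff_of_eq (congrArg (x ∈ ·) hI)).trans (by simp [TwoSidedIdeal.mem_top])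
  obtain ⟨n, -, ⟨e⟩⟩ := IsSimpleRing.exists_algEquiv_matrix_of_isAlgClosed F A
  obtain ⟨b, -⟩ := h.exists_basis
  refine ⟨n, ?_⟩
  rw [← Module.finrank_eq_nat_card_basis b, e.toLinearEquiv.finrank_eq, Module.finrank_matrix]
  simp

end basic

section iso

variable {A : Type*} [Ring A] [Algebra F A] {φ : A →ₗ[F] A} {Γ : G → Submodule F A}
  {A' : Type*} [Ring A'] [Algebra F A'] {φ' : A' →ₗ[F] A'} {Γ' : G → Submodule F A'}
  {T : Subgroup G} {τ τ' : G → F}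

open scoped TensorProduct in
/-- Two systems of structure constants with the same commutation factors are cohomologous. -/
theorem exists_scaling [IsAlgClosed F] (h : IsGradedDivInv φ Γ T τ)
    (h' : IsGradedDivInv φ' Γ' T τ') (hτ : ∀ s ∈ T, τ s = τ' s)
    {X : T → A} {X' : T → A'} (hX : ∀ s : T, X s ∈ Γ s) (hX' : ∀ s : T, X' s ∈ Γ' s)
    (hX0 : ∀ s, X s ≠ 0) (hX0' : ∀ s, X' s ≠ 0) :
    ∃ μ : T → F, (∀ s, μ s ≠ 0) ∧ ∀ (s t : T) (c c' : F), X s * X t = c • X (s * t) →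
      X' s * X' t = c' • X' (s * t) → μ s * μ t * c' = c * μ (s * t) := by
  have := h.nontrivial
  have := h'.nontrivial
  have := h.finite
  have := h'.finite
  choose U hU using fun s => h.isUnit (hX s) (hX0 s)
  choose W hW using fun s => h'.isUnit (hX' s) (hX0' s)
  let Z : T → A ⊗[F] A'ᵐᵒᵖ := fun s => X s ⊗ₜ[F] MulOpposite.op (↑(W s)⁻¹ : A')
  have hWW : ∀ s t : T, (↑(W t)⁻¹ : A') * ↑(W s)⁻¹ = polar τ s t • (↑(W s)⁻¹ * ↑(W t)⁻¹) := by
    intro s t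
    have h1 := h'.mul_comm_smul s.2 t.2 (hX' s) (hX' t)
    have h2 : polar τ s t = polar τ' s t := by
      simp only [polar, hτ _ s.2, hτ _ t.2, hτ _ (T.mul_mem s.2 t.2)]
    rw [← h2, ← hW, ← hW] at h1
    have h3 : (↑(W s)⁻¹ : A') * ↑(W t)⁻¹ * (↑(W s) * ↑(W t)) * (↑(W t)⁻¹ * ↑(W s)⁻¹)
        = (↑(W s)⁻¹ : A') * ↑(W t)⁻¹ := by
      simp [mul_assoc]
    have h4 : (↑(W s)⁻¹ : A') * ↑(W t)⁻¹ * (↑(W t) * ↑(W s)) = 1 := by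
      simp [mul_assoc]
    rw [h1, mul_smul_comm, h4, smul_mul_assoc, one_mul] at h3
    have h5 := h.polar_mul_self s.2 t.2
    rw [← h3, smul_smul, h5, one_smul]
  have hcomm : ∀ a ∈ Set.range Z, ∀ b ∈ Set.range Z, a * b = b * a := by
    rintro _ ⟨s, rfl⟩ _ ⟨t, rfl⟩
    simp only [Z, Algebra.TensorProduct.tmul_mul_tmul, ← MulOpposite.op_mul]
    rw [h.mul_comm_smul s.2 t.2 (hX s) (hX t), hWW, MulOpposite.op_smul,
      TensorProduct.tmul_smul, TensorProduct.smul_tmul', smul_smul, h.polar_mul_self s.2 t.2,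
      one_smul]
  let S := Algebra.adjoin F (Set.range Z)
  have : IsMulCommutative S := Algebra.isMulCommutative_adjoin F hcomm
  let _ : CommRing S := { S.toRing with mul_comm := mul_comm' }
  obtain ⟨m, hm⟩ := Ideal.exists_maximal S
  let _ : Field (S ⧸ m) := Ideal.Quotient.field m
  have : FiniteDimensional F (S ⧸ m) := inferInstance
  let e := AlgEquiv.ofBijective (Algebra.ofId F (S ⧸ m))
    (IsAlgClosed.algebraMap_bijective_of_isIntegral (k := F) (K := S ⧸ m))
  let χ : S →ₐ[F] F := e.symm.toAlgHom.comp (Ideal.Quotient.mkₐ F m)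
  let z : T → S := fun s => ⟨Z s, Algebra.subset_adjoin ⟨s, rfl⟩⟩
  have hmul : ∀ (s t : T) (c c' : F), X s * X t = c • X (s * t) →
      X' s * X' t = c' • X' (s * t) → c' • (z s * z t) = c • z (s * t) := by
    intro s t c c' hc hc'
    refine Subtype.ext ?_
    change c' • (Z s * Z t) = c • Z (s * t)
    simp only [Z, Algebra.TensorProduct.tmul_mul_tmul, ← MulOpposite.op_mul]
    have h1 : c' • ((↑(W t)⁻¹ : A') * ↑(W s)⁻¹) = ↑(W (s * t))⁻¹ := by
      rw [← hW, ← hW, ← hW] at hc'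
      have h2 : (↑(W (s * t))⁻¹ : A') * (↑(W s) * ↑(W t)) * (↑(W t)⁻¹ * ↑(W s)⁻¹)
        = (↑(W (s * t))⁻¹ : A') := by simp [mul_assoc]
      rw [hc', mul_smul_comm, Units.inv_mul, smul_mul_assoc, one_mul] at h2
      exact h2
    rw [hc, ← h1, MulOpposite.op_smul, TensorProduct.tmul_smul, ← TensorProduct.smul_tmul',
      smul_comm]
  have hex : ∀ s t : T, (∃ c : F, X s * X t = c • X (s * t)) ∧
      ∃ c : F, X' s * X' t = c • X' (s * t) := fun s t =>
    ⟨h.exists_smul (hX _) (h.mul_mem (hX s) (hX t)) (hX0 _),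
      h'.exists_smul (hX' _) (h'.mul_mem (hX' s) (hX' t)) (hX0' _)⟩
  have hχmul : ∀ (s t : T) (c c' : F), X s * X t = c • X (s * t) →
      X' s * X' t = c' • X' (s * t) → χ (z s) * χ (z t) * c' = c * χ (z (s * t)) := by
    intro s t c c' hc hc'
    have := congrArg χ (hmul s t c c' hc hc')
    rw [map_smul, map_smul, map_mul, smul_eq_mul, smul_eq_mul] at this
    rw [← this, mul_comm]
  have hone : χ (z 1) ≠ 0 := by
    obtain ⟨a, ha⟩ : ∃ a : F, X 1 = a • (1 : A) :=
      h.exists_smul h.one_mem (hX 1) one_ne_zero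
    obtain ⟨b, hb⟩ : ∃ b : F, (↑(W 1)⁻¹ : A') = b • (1 : A') := by
      obtain ⟨b, hb⟩ : ∃ a : F, (1 : A') = a • X' 1 :=
        h'.exists_smul (hX' 1) h'.one_mem (hX0' 1)
      refine ⟨b, ?_⟩
      have h2 := congrArg ((↑(W 1)⁻¹ : A') * ·) hb
      simp only [← hW, mul_one, mul_smul_comm, Units.inv_mul] at h2
      exact h2
    have ha0 : a ≠ 0 := fun h0 => hX0 1 (by simp [ha, h0])
    have hb0 : b ≠ 0 := fun h0 => (W 1)⁻¹.ne_zero (by simp [hb, h0])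
    have hz : z 1 = (a * b) • (1 : S) := by
      refine Subtype.ext ?_
      change Z 1 = (a * b) • (1 : A ⊗[F] A'ᵐᵒᵖ)
      simp only [Z, ha, hb, MulOpposite.op_smul, MulOpposite.op_one]
      rw [TensorProduct.tmul_smul, TensorProduct.smul_tmul', smul_smul, mul_comm,
        Algebra.TensorProduct.one_def, TensorProduct.smul_tmul']
    rw [hz, map_smul, map_one, smul_eq_mul, mul_one]
    exact _root_.mul_ne_zero ha0 hb0
  refine ⟨fun s => χ (z s), fun s hs => ?_, hχmul⟩
  replace hs : χ (z s) = 0 := hs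
  obtain ⟨⟨c, hc⟩, c', hc'⟩ := hex s s⁻¹
  have h1 := hχmul _ _ _ _ hc hc'
  rw [hs, zero_mul, zero_mul, mul_inv_cancel, eq_comm, mul_eq_zero] at h1
  refine h1.elim (fun h0 => ?_) hone
  rw [h0, zero_smul] at hc
  exact h.mul_ne_zero (hX s) (hX0 _) (hX0 _) hc

/-- Two graded-division algebras with involution of this kind which have the same support and
on which the involutions act by the same scalars are isomorphic. -/
theorem exists_algEquiv [IsAlgClosed F] (h : IsGradedDivInv φ Γ T τ)
    (h' : IsGradedDivInv φ' Γ' T τ') (hτ : ∀ s ∈ T, τ s = τ' s) :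
    ∃ e : A ≃ₐ[F] A', (∀ x, e (φ x) = φ' (e x)) ∧
      ∀ g, Submodule.map (e : A →ₗ[F] A') (Γ g) = Γ' g := by
  obtain ⟨b, hb⟩ := h.exists_basis
  obtain ⟨b', hb'⟩ := h'.exists_basis
  have := h.nontrivial
  have := h'.nontrivial
  obtain ⟨μ, hμ0, hμ⟩ := h.exists_scaling h' hτ hb hb' b.ne_zero b'.ne_zero
  let e₀ : A ≃ₗ[F] A' := b.equiv (b'.isUnitSMul fun s => (hμ0 s).isUnit) (Equiv.refl T)
  have he₀ : ∀ s, e₀ (b s) = μ s • b' s := fun s => by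
    simp [e₀, Module.Basis.isUnitSMul_apply]
  have hmul : ∀ x y, e₀ (x * y) = e₀ x * e₀ y := by
    have : (LinearMap.mul F A).compr₂ (e₀ : A →ₗ[F] A')
        = (LinearMap.mul F A').compl₁₂ (e₀ : A →ₗ[F] A') (e₀ : A →ₗ[F] A') := by
      refine b.ext fun s => b.ext fun t => ?_
      simp only [LinearMap.compr₂_apply, LinearMap.mul_apply', LinearEquiv.coe_coe,
        LinearMap.compl₁₂_apply]
      obtain ⟨c, hc⟩ := h.exists_smul (hb (s * t)) (h.mul_mem (hb s) (hb t)) (b.ne_zero _)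
      obtain ⟨c', hc'⟩ := h'.exists_smul (hb' (s * t)) (h'.mul_mem (hb' s) (hb' t))
        (b'.ne_zero _)
      rw [hc, map_smul, he₀, he₀, he₀, smul_mul_smul_comm, hc', smul_smul, smul_smul,
        hμ s t c c' hc hc']
    exact fun x y => LinearMap.congr_fun (LinearMap.congr_fun this x) y
  have hone : e₀ 1 = 1 := by
    have := hmul 1 (e₀.symm 1)
    rw [one_mul, e₀.apply_symm_apply, mul_one] at this
    exact this.symm
  refine ⟨AlgEquiv.ofLinearEquiv e₀ hone hmul, ?_, fun g => ?_⟩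
  · have : (e₀ : A →ₗ[F] A') ∘ₗ φ = φ' ∘ₗ (e₀ : A →ₗ[F] A') := by
      refine b.ext fun s => ?_
      simp only [LinearMap.comp_apply, LinearEquiv.coe_coe]
      rw [h.inv_apply s.2 (hb s), map_smul, he₀, map_smul, h'.inv_apply s.2 (hb' s), hτ _ s.2,
        smul_comm]
    exact fun x => LinearMap.congr_fun this x
  · by_cases hg : g ∈ T
    · apply le_antisymm
      · rintro _ ⟨x, hx, rfl⟩
        obtain ⟨c, rfl⟩ := h.exists_smul (hb ⟨g, hg⟩) hx (b.ne_zero _)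
        change e₀ (c • b ⟨g, hg⟩) ∈ Γ' g
        rw [map_smul, he₀]
        exact Submodule.smul_mem _ _ (Submodule.smul_mem _ _ (hb' ⟨g, hg⟩))
      · intro y hy
        obtain ⟨c, rfl⟩ := h'.exists_smul (hb' ⟨g, hg⟩) hy (b'.ne_zero _)
        refine ⟨(c * (μ ⟨g, hg⟩)⁻¹) • b ⟨g, hg⟩, Submodule.smul_mem _ _ (hb ⟨g, hg⟩), ?_⟩
        change e₀ _ = _
        rw [map_smul, he₀, smul_smul, mul_assoc, inv_mul_cancel₀ (hμ0 _), mul_one]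
    · rw [not_not.1 (mt (h.ne_bot_iff g).1 hg), not_not.1 (mt (h'.ne_bot_iff g).1 hg),
        Submodule.map_bot]

/-- A graded isomorphism preserves the support and the scalars. -/
theorem eq_of_algEquiv (h : IsGradedDivInv φ Γ T τ) {T' : Subgroup G}
    (h' : IsGradedDivInv φ' Γ' T' τ') (e : A ≃ₐ[F] A') (he : ∀ x, e (φ x) = φ' (e x))
    (hΓ : ∀ g, Submodule.map (e : A →ₗ[F] A') (Γ g) = Γ' g) :
    T = T' ∧ ∀ s ∈ T, τ s = τ' s := by
  have key : ∀ g, g ∈ T → g ∈ T' ∧ τ g = τ' g := by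
    intro g hg
    obtain ⟨x, hx, hx0⟩ := h.exists_mem_ne_zero hg
    have hex : e x ∈ Γ' g := hΓ g ▸ ⟨x, hx, rfl⟩
    have hex0 : e x ≠ 0 := by simpa using hx0
    have hg' := h'.mem_of_ne_zero hex hex0
    have := he x
    rw [h.inv_apply hg hx, map_smul, h'.inv_apply hg' hex] at this
    exact ⟨hg', smul_left_injective F hex0 this⟩
  refine ⟨le_antisymm (fun g hg => (key g hg).1) fun g hg => ?_, fun s hs => (key s hs).2⟩
  rw [← h.ne_bot_iff]
  rintro h0
  refine (h'.ne_bot_iff g).2 hg ?_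
  rw [← hΓ, h0, Submodule.map_bot]

end iso

section exchange

variable {A : Type*} [Ring A] [Algebra F A] {φ : A →ₗ[F] A} {Γ : G → Submodule F A}
  {T : Subgroup G} {τ : G → F} {t : G}

omit [DecidableEq G] in
theorem mem_exGrT {h : G} {p : A × Aᵐᵒᵖ} : p ∈ exGrT F G φ Γ t h ↔
    ∃ x ∈ Γ h, ∃ y ∈ Γ (h * t), p = (x + y, MulOpposite.op (φ x - φ y)) := by
  constructor
  · rintro ⟨⟨x, y⟩, ⟨hx, hy⟩, rfl⟩
    exact ⟨x, hx, y, hy, rfl⟩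
  · rintro ⟨x, hx, y, hy, rfl⟩
    exact ⟨(x, y), ⟨hx, hy⟩, rfl⟩

omit [DecidableEq G] in
theorem mem_sup_zpowers (ht : t * t = 1) {s : G} :
    s ∈ T ⊔ Subgroup.zpowers t ↔ s ∈ T ∨ s * t ∈ T := by
  constructor
  · intro hs
    obtain ⟨u, hu, v, hv, rfl⟩ := Subgroup.mem_sup.1 hs
    obtain ⟨k, rfl⟩ := Subgroup.mem_zpowers_iff.1 hv
    have ht2 : t ^ (2 : ℤ) = 1 := by rw [zpow_two, ht]
    rcases Int.even_or_odd' k with ⟨c, rfl | rfl⟩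
    · left
      rwa [zpow_mul, ht2, one_zpow, mul_one]
    · right
      rwa [zpow_add, zpow_mul, ht2, one_zpow, one_mul, zpow_one, mul_assoc, ht, mul_one]
  · rintro (hs | hs)
    · exact Subgroup.mem_sup_left hs
    · have := (T ⊔ Subgroup.zpowers t).mul_mem (Subgroup.mem_sup_left hs)
        (Subgroup.mem_sup_right (Subgroup.mem_zpowers t))
      rwa [mul_assoc, ht, mul_one] at this

omit [DecidableEq G] in
theorem exInvG_apply (p : A × Aᵐᵒᵖ) : exInvG F A p = (p.2.unop, MulOpposite.op p.1) := rfl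

theorem exInvG_mul (x y : A × Aᵐᵒᵖ) : exInvG F A (x * y) = exInvG F A y * exInvG F A x := rfl

theorem exInvG_exInvG (x : A × Aᵐᵒᵖ) : exInvG F A (exInvG F A x) = x := rfl

omit [DecidableEq G] in
theorem _root_.tauExt_of_mem {s : G} (hs : s ∈ T) : tauExt F G T t τ s = τ s := if_pos hs

omit [DecidableEq G] in
theorem _root_.tauExt_of_notMem {s : G} (hs : s ∉ T) : tauExt F G T t τ s = -τ (s * t) :=
  if_neg hs

theorem isUnit_exchange (h : IsGradedDivInv φ Γ T τ) {g : G} {x y : A} (hx : x ∈ Γ g)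
    (hx0 : x ≠ 0) (hy : y ∈ Γ g) (hy0 : y ≠ 0) : IsUnit (x, MulOpposite.op y) :=
  Prod.isUnit_iff.2 ⟨h.isUnit hx hx0, (h.isUnit hy hy0).op⟩

theorem internal_exGrT (h : IsGradedDivInv φ Γ T τ) (h2 : (2 : F) ≠ 0) (ht : t * t = 1) :
    DirectSum.IsInternal (exGrT F G φ Γ t) := by
  have hφ : Function.Injective φ := Function.LeftInverse.injective h.inv_inv
  have htt : ∀ g : G, g * t * t = g := fun g => by rw [mul_assoc, ht, mul_one]
  rw [DirectSum.isInternal_submodule_iff_iSupIndep_and_iSup_eq_top]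
  constructor
  · -- linear maps that recover twice the two coordinates
    let p : (A × Aᵐᵒᵖ) →ₗ[F] A :=
      LinearMap.fst F A Aᵐᵒᵖ + φ ∘ₗ (MulOpposite.opLinearEquiv F).symm.toLinearMap ∘ₗ
        LinearMap.snd F A Aᵐᵒᵖ
    let q : (A × Aᵐᵒᵖ) →ₗ[F] A :=
      LinearMap.fst F A Aᵐᵒᵖ - φ ∘ₗ (MulOpposite.opLinearEquiv F).symm.toLinearMap ∘ₗ
        LinearMap.snd F A Aᵐᵒᵖ
    have hp : ∀ x y, p (x + y, MulOpposite.op (φ x - φ y)) = (2 : F) • x := fun x y => by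
      simp only [p, LinearMap.add_apply, LinearMap.fst_apply, LinearMap.comp_apply,
        LinearMap.snd_apply, LinearEquiv.coe_coe, MulOpposite.coe_opLinearEquiv_symm,
        MulOpposite.unop_op, map_sub, h.inv_inv]
      rw [two_smul]
      abel
    have hq : ∀ x y, q (x + y, MulOpposite.op (φ x - φ y)) = (2 : F) • y := fun x y => by
      simp only [q, LinearMap.sub_apply, LinearMap.fst_apply, LinearMap.comp_apply,
        LinearMap.snd_apply, LinearEquiv.coe_coe, MulOpposite.coe_opLinearEquiv_symm,
        MulOpposite.unop_op, map_sub, h.inv_inv]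
      rw [two_smul]
      abel
    have hpm : ∀ g, (exGrT F G φ Γ t g).map p ≤ Γ g := by
      rintro g _ ⟨z, hz, rfl⟩
      obtain ⟨x, hx, y, hy, rfl⟩ := mem_exGrT.1 hz
      rw [hp]
      exact Submodule.smul_mem _ _ hx
    have hqm : ∀ g, (exGrT F G φ Γ t g).map q ≤ Γ (g * t) := by
      rintro g _ ⟨z, hz, rfl⟩
      obtain ⟨x, hx, y, hy, rfl⟩ := mem_exGrT.1 hz
      rw [hq]
      exact Submodule.smul_mem _ _ hy
    have hind := h.internal.submodule_iSupIndep
    intro g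
    rw [Submodule.disjoint_def]
    intro z hz hz'
    obtain ⟨x, hx, y, hy, rfl⟩ := mem_exGrT.1 hz
    have hx0 : (2 : F) • x = 0 := by
      refine Submodule.disjoint_def.1 (hind g) _ (Submodule.smul_mem _ _ hx) ?_
      rw [← hp x y]
      have := Submodule.mem_map_of_mem (f := p) hz'
      simp only [Submodule.map_iSup] at this
      exact (iSup₂_mono fun j _ => hpm j) this
    have hy0 : (2 : F) • y = 0 := by
      refine Submodule.disjoint_def.1 (hind (g * t)) _ (Submodule.smul_mem _ _ hy) ?_
      rw [← hq x y]
      have := Submodule.mem_map_of_mem (f := q) hz'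
      simp only [Submodule.map_iSup] at this
      refine (iSup₂_le fun j hj => (hqm j).trans ?_) this
      exact le_iSup₂_of_le (j * t) (fun hjt => hj (mul_right_cancel hjt)) le_rfl
    rw [(smul_eq_zero.1 hx0).resolve_left h2, (smul_eq_zero.1 hy0).resolve_left h2]
    simp
  · let j : A →ₗ[F] A × Aᵐᵒᵖ :=
      LinearMap.prod LinearMap.id ((MulOpposite.opLinearEquiv F).toLinearMap ∘ₗ φ)
    let k : A →ₗ[F] A × Aᵐᵒᵖ :=
      LinearMap.prod LinearMap.id (-((MulOpposite.opLinearEquiv F).toLinearMap ∘ₗ φ))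
    have hja : ∀ a, j a = (a, MulOpposite.op (φ a)) := fun _ => rfl
    have hka : ∀ a, k a = (a, -MulOpposite.op (φ a)) := fun _ => rfl
    have hj : ∀ a, j a ∈ ⨆ g, exGrT F G φ Γ t g := by
      intro a
      have ha : a ∈ ⨆ g, Γ g := by simp [h.internal.submodule_iSup_eq_top]
      have : (⨆ g, Γ g) ≤ (⨆ g, exGrT F G φ Γ t g).comap j := iSup_le fun g x hx =>
        Submodule.mem_iSup_of_mem g (mem_exGrT.2 ⟨x, hx, 0, Submodule.zero_mem _, by
          simp [hja]⟩)
      exact this ha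
    have hk : ∀ a, k a ∈ ⨆ g, exGrT F G φ Γ t g := by
      intro a
      have ha : a ∈ ⨆ g, Γ g := by simp [h.internal.submodule_iSup_eq_top]
      have : (⨆ g, Γ g) ≤ (⨆ g, exGrT F G φ Γ t g).comap k := iSup_le fun g x hx =>
        Submodule.mem_iSup_of_mem (g * t) (mem_exGrT.2 ⟨0, Submodule.zero_mem _, x, by
          rwa [htt], by simp [hka]⟩)
      exact this ha
    refine eq_top_iff.2 fun z _ => ?_
    have hz : z = (2 : F)⁻¹ • (j (z.1 + φ z.2.unop) + k (z.1 - φ z.2.unop)) := by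
      rw [eq_inv_smul_iff₀ h2, two_smul]
      refine Prod.ext ?_ (MulOpposite.unop_injective ?_)
      · simp only [hja, hka, Prod.fst_add]
        abel
      · simp only [hja, hka, Prod.snd_add, MulOpposite.unop_add, MulOpposite.unop_neg,
          MulOpposite.unop_op, map_add, map_sub, h.inv_inv]
        abel
    rw [hz]
    exact Submodule.smul_mem _ _ (Submodule.add_mem _ (hj _) (hk _))

theorem inv_mem (h : IsGradedDivInv φ Γ T τ) {g : G} {x : A} (hx : x ∈ Γ g) : φ x ∈ Γ g := by
  by_cases hg : g ∈ T
  · rw [h.inv_apply hg hx]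
    exact Submodule.smul_mem _ _ hx
  · rw [h.eq_zero_of_notMem hg hx, map_zero]
    exact Submodule.zero_mem _

/-- Elements of degree in `T` in the exchange grading. -/
theorem mem_exGrT_of_mem (h : IsGradedDivInv φ Γ T τ) (htT : t ∉ T) {g : G} (hg : g ∈ T)
    {p : A × Aᵐᵒᵖ} :
    p ∈ exGrT F G φ Γ t g ↔ ∃ x ∈ Γ g, p = (x, MulOpposite.op (φ x)) := by
  rw [mem_exGrT]
  constructor
  · rintro ⟨x, hx, y, hy, rfl⟩
    rw [h.eq_zero_of_notMem (fun hgt => htT ((T.mul_mem_cancel_left hg).1 hgt)) hy]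
    exact ⟨x, hx, by simp⟩
  · rintro ⟨x, hx, rfl⟩
    exact ⟨x, hx, 0, Submodule.zero_mem _, by simp⟩

/-- Elements of degree not in `T` in the exchange grading. -/
theorem mem_exGrT_of_notMem (h : IsGradedDivInv φ Γ T τ) {g : G} (hg : g ∉ T)
    {p : A × Aᵐᵒᵖ} :
    p ∈ exGrT F G φ Γ t g ↔ ∃ y ∈ Γ (g * t), p = (y, -MulOpposite.op (φ y)) := by
  rw [mem_exGrT]
  constructor
  · rintro ⟨x, hx, y, hy, rfl⟩
    rw [h.eq_zero_of_notMem hg hx]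
    exact ⟨y, hy, by simp⟩
  · rintro ⟨y, hy, rfl⟩
    exact ⟨0, Submodule.zero_mem _, y, hy, by simp⟩

/-- The exchange construction again yields a graded-division algebra with involution. -/
theorem exchange (h : IsGradedDivInv φ Γ T τ) (h2 : (2 : F) ≠ 0) (htT : t ∉ T)
    (ht : t * t = 1) :
    IsGradedDivInv (exInvG F A) (exGrT F G φ Γ t) (T ⊔ Subgroup.zpowers t)
      (tauExt F G T t τ) := by
  have hφ : Function.Injective φ := Function.LeftInverse.injective h.inv_inv
  have := h.finite
  refine ⟨h.internal_exGrT h2 ht, ?_, ?_, inferInstance, ?_, ?_, ?_, exInvG_exInvG, exInvG_mul,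
    ?_⟩
  · rw [h.mem_exGrT_of_mem htT T.one_mem]
    refine ⟨1, h.one_mem, ?_⟩
    rw [h.inv_apply T.one_mem h.one_mem, h.tau_one, one_smul]
    rfl
  · intro g k p q hp hq
    obtain ⟨x, hx, y, hy, rfl⟩ := mem_exGrT.1 hp
    obtain ⟨x', hx', y', hy', rfl⟩ := mem_exGrT.1 hq
    refine mem_exGrT.2 ⟨x * x' + y * y', ?_, x * y' + y * x', ?_, ?_⟩
    · refine Submodule.add_mem _ (h.mul_mem hx hx') ?_
      have := h.mul_mem hy hy'
      rwa [mul_mul_mul_comm, ht, mul_one] at this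
    · refine Submodule.add_mem _ ?_ ?_
      · rw [mul_assoc]
        exact h.mul_mem hx hy'
      · rw [mul_right_comm]
        exact h.mul_mem hy hx'
    · refine Prod.ext ?_ (MulOpposite.unop_injective ?_)
      · simp only [Prod.mk_mul_mk]
        noncomm_ring
      · simp only [Prod.mk_mul_mk, MulOpposite.unop_mul, MulOpposite.unop_op, map_add, h.inv_mul]
        noncomm_ring
  · intro g p hp hp0
    by_cases hg : g ∈ T
    · obtain ⟨x, hx, rfl⟩ := (h.mem_exGrT_of_mem htT hg).1 hp
      have hx0 : x ≠ 0 := by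
        rintro rfl
        simp at hp0
      exact h.isUnit_exchange hx hx0 (h.inv_mem hx) ((map_ne_zero_iff _ hφ).2 hx0)
    · obtain ⟨x, hx, rfl⟩ := (h.mem_exGrT_of_notMem hg).1 hp
      have hx0 : x ≠ 0 := by
        rintro rfl
        simp at hp0
      exact h.isUnit_exchange hx hx0 (neg_mem (h.inv_mem hx))
        (neg_ne_zero.2 ((map_ne_zero_iff _ hφ).2 hx0))
  · intro g
    rw [mem_sup_zpowers ht, Submodule.ne_bot_iff]
    by_cases hg : g ∈ T
    · refine iff_of_true ?_ (Or.inl hg)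
      obtain ⟨x, hx, hx0⟩ := h.exists_mem_ne_zero hg
      exact ⟨_, (h.mem_exGrT_of_mem htT hg).2 ⟨x, hx, rfl⟩, fun h0 => hx0 (congrArg Prod.fst h0)⟩
    · constructor
      · rintro ⟨p, hp, hp0⟩
        obtain ⟨x, hx, rfl⟩ := (h.mem_exGrT_of_notMem hg).1 hp
        refine Or.inr (h.mem_of_ne_zero hx ?_)
        rintro rfl
        simp at hp0
      · rintro (hg' | hg')
        · exact absurd hg' hg
        obtain ⟨x, hx, hx0⟩ := h.exists_mem_ne_zero hg'
        exact ⟨_, (h.mem_exGrT_of_notMem hg).2 ⟨x, hx, rfl⟩,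
          fun h0 => hx0 (congrArg Prod.fst h0)⟩
  · intro g p q hp hq hp0
    by_cases hg : g ∈ T
    · obtain ⟨x, hx, rfl⟩ := (h.mem_exGrT_of_mem htT hg).1 hp
      obtain ⟨y, hy, rfl⟩ := (h.mem_exGrT_of_mem htT hg).1 hq
      have hx0 : x ≠ 0 := by
        rintro rfl
        simp at hp0
      obtain ⟨c, rfl⟩ := h.exists_smul hx hy hx0
      exact ⟨c, by simp⟩
    · obtain ⟨x, hx, rfl⟩ := (h.mem_exGrT_of_notMem hg).1 hp
      obtain ⟨y, hy, rfl⟩ := (h.mem_exGrT_of_notMem hg).1 hq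
      have hx0 : x ≠ 0 := by
        rintro rfl
        simp at hp0
      obtain ⟨c, rfl⟩ := h.exists_smul hx hy hx0
      exact ⟨c, by simp⟩
  · intro g p hgT hp
    by_cases hg : g ∈ T
    · obtain ⟨x, hx, rfl⟩ := (h.mem_exGrT_of_mem htT hg).1 hp
      rw [tauExt_of_mem hg, exInvG_apply, h.inv_apply hg hx]
      refine Prod.ext rfl (MulOpposite.unop_injective ?_)
      simp [smul_smul, h.tau_mul_self hg]
    · obtain ⟨x, hx, rfl⟩ := (h.mem_exGrT_of_notMem hg).1 hp
      have hgt := ((mem_sup_zpowers ht).1 hgT).resolve_left hg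
      rw [tauExt_of_notMem hg, exInvG_apply, h.inv_apply hgt hx]
      refine Prod.ext ?_ (MulOpposite.unop_injective ?_)
      · simp
      · simp [smul_smul, h.tau_mul_self hgt]

end exchange

section restrict

variable {A : Type*} [Ring A] [Algebra F A] {φ : A →ₗ[F] A} {Γ : G → Submodule F A}
  {T : Subgroup G} {τ : G → F}

theorem exists_isDinv (h : IsGradedDivInv φ Γ T τ) :
    ∃ X : G → A, IsDinv F G A φ Γ X T (polar τ) τ := by
  have : ∀ s : G, ∃ x ∈ Γ s, s ∈ T → x ≠ 0 := fun s => by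
    by_cases hs : s ∈ T
    · obtain ⟨x, hx, hx0⟩ := h.exists_mem_ne_zero hs
      exact ⟨x, hx, fun _ => hx0⟩
    · exact ⟨0, Submodule.zero_mem _, fun hs' => absurd hs' hs⟩
  choose X hX hX0 using this
  exact ⟨X, h.internal, h.one_mem, fun _ _ _ hx _ hy => h.mul_mem hx hy, h.finite,
    fun _ _ hx hx0 => h.isUnit hx hx0, h.ne_bot_iff,
    fun s hs => ⟨hX0 s hs, hX s, fun _ hx => h.exists_smul (hX s) hx (hX0 s hs)⟩,
    fun s hs t ht => h.mul_comm_smul hs ht (hX s) (hX t), h.inv_inv, h.inv_mul,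
    fun _ hs _ hx => h.inv_apply hs hx⟩

/-- The homogeneous elements with degree in a subgroup `T₀` of the support span a subalgebra of
the same kind. -/
theorem exists_restrict (h : IsGradedDivInv φ Γ T τ) (hT : ∀ s ∈ T, s * s = 1)
    {T₀ : Subgroup G} (hT₀ : T₀ ≤ T) :
    ∃ (S : Subalgebra F A) (φ₀ : S →ₗ[F] S) (Γ₀ : G → Submodule F S),
      IsGradedDivInv φ₀ Γ₀ T₀ τ := by
  have := h.nontrivial
  have := h.finite
  let M : Submodule F A := ⨆ s : T₀, Γ s
  have hmemM : ∀ s ∈ T₀, Γ s ≤ M := fun s hs => le_iSup (fun s : T₀ => Γ s) ⟨s, hs⟩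
  have hmul : ∀ x y, x ∈ M → y ∈ M → x * y ∈ M := by
    intro x y hx hy
    have h1 : ∀ s ∈ T₀, ∀ x ∈ Γ s, M ≤ M.comap (LinearMap.mulLeft F x) := fun s hs x hx =>
      iSup_le fun r y hy => hmemM _ (T₀.mul_mem hs r.2) (h.mul_mem hx hy)
    have h2 : M ≤ M.comap (LinearMap.mulRight F y) :=
      iSup_le fun s x hx => h1 s s.2 x hx hy
    exact h2 hx
  let S : Subalgebra F A := M.toSubalgebra (hmemM 1 T₀.one_mem h.one_mem) hmul
  have hφM : ∀ x ∈ M, φ x ∈ M := by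
    have : M ≤ M.comap φ := iSup_le fun s x hx => hmemM s s.2 (h.inv_mem hx)
    exact this
  let φ₀ : S →ₗ[F] S := φ.restrict (p := M) (q := M) hφM
  let v : S →ₗ[F] A := S.val.toLinearMap
  have hv : Function.Injective v := Subtype.val_injective
  have hind := h.internal.submodule_iSupIndep
  have hmap : ∀ g, ((Γ g).comap v).map v ≤ Γ g := fun g => Submodule.map_comap_le _ _
  have hM0 : ∀ g ∉ T₀, ∀ x ∈ Γ g, x ∈ M → x = 0 := fun g hg x hx hxM =>
    Submodule.disjoint_def.1 (hind g) x hx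
      ((iSup_le fun s : T₀ => le_iSup₂_of_le (s : G) (fun hsg : (s : G) = g => hg (hsg ▸ s.2))
        le_rfl : M ≤ ⨆ j, ⨆ (_ : j ≠ g), Γ j) hxM)
  refine ⟨S, φ₀, fun g => (Γ g).comap v, ?_, h.one_mem, fun hx hy => h.mul_mem hx hy,
    inferInstance, ?_, ?_, ?_, ?_, ?_, ?_⟩
  · rw [DirectSum.isInternal_submodule_iff_iSupIndep_and_iSup_eq_top]
    constructor
    · intro g
      rw [Submodule.disjoint_def]
      intro x hx hx'
      refine hv ?_
      rw [map_zero]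
      refine Submodule.disjoint_def.1 (hind g) _ hx ?_
      have := Submodule.mem_map_of_mem (f := v) hx'
      simp only [Submodule.map_iSup] at this
      exact (iSup₂_mono fun j _ => hmap j) this
    · rw [eq_top_iff]
      rintro x -
      have h1 : M ≤ (⨆ g, (Γ g).comap v).map v := iSup_le fun s y hy =>
        ⟨⟨y, hmemM s s.2 hy⟩, Submodule.mem_iSup_of_mem (s : G) hy, rfl⟩
      obtain ⟨y, hy, hyx⟩ := h1 x.2
      rwa [← hv hyx]
  · intro g x hx hx0
    have hx0' : (x : A) ≠ 0 := fun h0 => hx0 (Subtype.ext h0)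
    have hg : g ∈ T := h.mem_of_ne_zero hx hx0'
    have hxx : (x : A) * x ∈ Γ 1 := hT g hg ▸ h.mul_mem hx hx
    obtain ⟨c, hc⟩ := h.exists_smul h.one_mem hxx one_ne_zero
    have hc0 : c ≠ 0 := by
      rintro rfl
      exact h.mul_ne_zero hx hx0' hx0' (hc.trans (zero_smul F _))
    have hxx' : x * x = c • 1 := Subtype.ext hc
    refine ⟨⟨x, c⁻¹ • x, ?_, ?_⟩, rfl⟩
    · rw [mul_smul_comm, hxx', inv_smul_smul₀ hc0]
    · rw [smul_mul_assoc, hxx', inv_smul_smul₀ hc0]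
  · intro g
    rw [Submodule.ne_bot_iff]
    constructor
    · rintro ⟨x, hx, hx0⟩
      by_contra hg
      exact hx0 (Subtype.ext (hM0 g hg x hx x.2))
    · intro hg
      obtain ⟨x, hx, hx0⟩ := h.exists_mem_ne_zero (hT₀ hg)
      exact ⟨⟨x, hmemM g hg hx⟩, hx, fun h0 => hx0 (congrArg Subtype.val h0)⟩
  · intro g x y hx hy hx0
    obtain ⟨c, hc⟩ := h.exists_smul hx hy fun h0 => hx0 (Subtype.ext h0)
    exact ⟨c, Subtype.ext hc⟩
  · exact fun a => Subtype.ext (h.inv_inv a)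
  · exact fun a b => Subtype.ext (h.inv_mul a b)
  · exact fun hg hx => Subtype.ext (h.inv_apply (hT₀ hg) hx)

end restrict

end IsGradedDivInv

section structure_theory

variable [IsAlgClosed F] {A : Type*} [Ring A] [Algebra F A] [FiniteDimensional F A]
  [Nontrivial A] {φ : A →ₗ[F] A} {Γ : G → Submodule F A}

theorem exists_smul_of_isUnit {ι : Type*} {Γ : ι → Submodule F A}
    (hunit : ∀ g, ∀ x ∈ Γ g, x ≠ 0 → IsUnit x) {g : ι} {x y : A} (hx : x ∈ Γ g) (hy : y ∈ Γ g) (hx0 : x ≠ 0) :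
    ∃ c : F, y = c • x := by
  obtain ⟨u, rfl⟩ := hunit g x hx hx0
  obtain ⟨c, hc⟩ := spectrum.nonempty_of_isAlgClosed_of_finiteDimensional F ((↑u⁻¹ : A) * y)
  refine ⟨c, ?_⟩
  by_contra hne
  have h1 : IsUnit (c • (u : A) - y) :=
    hunit g _ (Submodule.sub_mem _ (Submodule.smul_mem _ _ hx) hy)
      (sub_ne_zero.2 fun h => hne h.symm)
  refine spectrum.mem_iff.1 hc ?_
  have h2 : algebraMap F A c - ↑u⁻¹ * y = ↑u⁻¹ * (c • (u : A) - y) := by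
    rw [mul_sub, mul_smul_comm, Units.inv_mul, Algebra.algebraMap_eq_smul_one]
  rw [h2]
  exact u⁻¹.isUnit.mul h1

/-- In an algebra which is simple as an algebra with involution, symmetric central elements are
scalars. -/
theorem exists_algebraMap_of_central (hinv_mul : ∀ a b, φ (a * b) = φ b * φ a)
    (hφ1 : φ 1 = 1)
    (hsimple : ∀ I : Submodule F A, (∀ a : A, ∀ x ∈ I, a * x ∈ I ∧ x * a ∈ I) →
      (∀ x ∈ I, φ x ∈ I) → I = ⊥ ∨ I = ⊤)
    {z : A} (hz : ∀ a, z * a = a * z) (hφz : φ z = z) : ∃ c : F, z = c • (1 : A) := by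
  obtain ⟨c, hc⟩ := spectrum.nonempty_of_isAlgClosed_of_finiteDimensional F z
  refine ⟨c, ?_⟩
  set w := algebraMap F A c - z with hw
  have hwc : ∀ a, w * a = a * w := fun a => by
    rw [hw, sub_mul, mul_sub, hz, Algebra.commutes]
  have hφw : φ w = w := by
    rw [hw, map_sub, hφz, Algebra.algebraMap_eq_smul_one, map_smul, hφ1]
  rcases hsimple (LinearMap.range (LinearMap.mulLeft F w)) (fun a x hx => by
      obtain ⟨b, rfl⟩ := hx
      refine ⟨⟨a * b, ?_⟩, ⟨b * a, ?_⟩⟩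
      · simp only [LinearMap.mulLeft_apply]
        rw [← mul_assoc, hwc, mul_assoc]
      · simp only [LinearMap.mulLeft_apply]
        rw [mul_assoc]) (fun x hx => by
      obtain ⟨b, rfl⟩ := hx
      refine ⟨φ b, ?_⟩
      simp only [LinearMap.mulLeft_apply]
      rw [hinv_mul, hφw, hwc]) with h0 | h1
  · have : w ∈ (⊥ : Submodule F A) := h0 ▸ ⟨1, by simp⟩
    rw [Submodule.mem_bot, hw, sub_eq_zero, Algebra.algebraMap_eq_smul_one] at this
    exact this.symm
  · obtain ⟨a, ha⟩ := (h1 ▸ Submodule.mem_top : (1 : A) ∈ LinearMap.range _)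
    rw [LinearMap.mulLeft_apply] at ha
    exact absurd ⟨⟨w, a, ha, by rw [← hwc, ha]⟩, rfl⟩ (spectrum.mem_iff.1 hc)

/-- A graded-division algebra with involution which is simple as an algebra with involution has
one-dimensional components, an elementary 2-group as support, and an involution which takes the
value `-1` on the nontrivial part of the radical. -/
theorem exists_isGradedDivInv (hint : DirectSum.IsInternal Γ) (hone : (1 : A) ∈ Γ 1)
    (hmul : ∀ g h : G, ∀ x ∈ Γ g, ∀ y ∈ Γ h, x * y ∈ Γ (g * h))
    (hunit : ∀ g : G, ∀ x ∈ Γ g, x ≠ 0 → IsUnit x)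
    (hinv : ∀ a, φ (φ a) = a) (hinv_mul : ∀ a b, φ (a * b) = φ b * φ a)
    (hφΓ : ∀ g : G, ∀ x ∈ Γ g, φ x ∈ Γ g)
    (hsimple : ∀ I : Submodule F A, (∀ a : A, ∀ x ∈ I, a * x ∈ I ∧ x * a ∈ I) →
      (∀ x ∈ I, φ x ∈ I) → I = ⊥ ∨ I = ⊤) :
    ∃ (T : Subgroup G) (τ : G → F), IsGradedDivInv φ Γ T τ ∧ (∀ s ∈ T, s * s = 1) ∧
      ∀ s ∈ T, (∀ v ∈ T, polar τ s v = 1) → τ s = 1 → s = 1 := by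
  have hφ1 : φ 1 = 1 := by
    have := hinv_mul (φ 1) 1
    rw [mul_one, hinv, mul_one] at this
    exact this.symm
  have hmul0 : ∀ {g : G} {x y : A}, x ∈ Γ g → x ≠ 0 → y ≠ 0 → x * y ≠ 0 :=
    fun {g x y} hx hx0 hy0 h0 => hy0 ((hunit g x hx hx0).mul_right_eq_zero.1 h0)
  have hcentral : ∀ {g : G} {z : A}, z ∈ Γ g → z ≠ 0 → φ z = z →
      (∀ k, ∀ y ∈ Γ k, z * y = y * z) → g = 1 := by
    intro g z hz hz0 hφz hzc
    have hzc' : ∀ a, z * a = a * z := by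
      have : ⨆ k, Γ k ≤ LinearMap.eqLocus (LinearMap.mulLeft F z) (LinearMap.mulRight F z) :=
        iSup_le fun k y hy => hzc k y hy
      rw [hint.submodule_iSup_eq_top] at this
      exact fun a => this (Submodule.mem_top (x := a))
    obtain ⟨c, hc⟩ := exists_algebraMap_of_central hinv_mul hφ1 hsimple hzc' hφz
    by_contra hg
    refine hz0 (Submodule.disjoint_def.1 (hint.submodule_iSupIndep.pairwiseDisjoint hg) z hz ?_)
    rw [hc]
    exact Submodule.smul_mem _ _ hone
  have hscalar : ∀ g, ∃ c : F, ∀ x ∈ Γ g, φ x = c • x := by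
    intro g
    by_cases hg : Γ g = ⊥
    · refine ⟨1, fun x hx => ?_⟩
      rw [hg, Submodule.mem_bot] at hx
      simp [hx]
    · obtain ⟨x, hx, hx0⟩ := (Submodule.ne_bot_iff _).1 hg
      obtain ⟨c, hc⟩ := exists_smul_of_isUnit hunit hx (hφΓ g x hx) hx0
      refine ⟨c, fun y hy => ?_⟩
      obtain ⟨d, rfl⟩ := exists_smul_of_isUnit hunit hx hy hx0
      rw [map_smul, hc, smul_comm]
  choose τ hτ using hscalar
  have hτ2 : ∀ {g x}, x ∈ Γ g → x ≠ 0 → τ g * τ g = 1 := by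
    intro g x hx hx0
    have h1 := hinv x
    rw [hτ g x hx, map_smul, hτ g x hx, smul_smul] at h1
    exact smul_left_injective F hx0 (by simpa using h1)
  have hsq : ∀ s, Γ s ≠ ⊥ → s * s = 1 := by
    intro s hs
    obtain ⟨x, hx, hx0⟩ := (Submodule.ne_bot_iff _).1 hs
    refine hcentral (hmul _ _ _ hx _ hx) (hmul0 hx hx0 hx0) ?_ ?_
    · rw [hinv_mul, hτ s x hx, smul_mul_smul_comm, hτ2 hx hx0, one_smul]
    · intro k y hy
      by_cases hy0 : y = 0
      · simp [hy0]
      obtain ⟨c, hc⟩ := exists_smul_of_isUnit hunit (hmul _ _ _ hy _ hx)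
        (mul_comm s k ▸ hmul _ _ _ hx _ hy) (hmul0 hy hy0 hx0)
      have hττ : τ k * τ s ≠ 0 := by
        refine mul_ne_zero (fun h0 => ?_) fun h0 => ?_
        · simpa [h0] using hτ2 hy hy0
        · simpa [h0] using hτ2 hx hx0
      have h1 := congrArg φ hc
      rw [hinv_mul, map_smul, hinv_mul, hτ k y hy, hτ s x hx, smul_mul_smul_comm,
        smul_mul_smul_comm, smul_smul, mul_comm (τ s), mul_comm c, mul_smul] at h1
      have h2 : y * x = c • (x * y) :=
        smul_right_injective A hττ (by simpa only [mul_smul] using h1)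
      have h3 : c * c = 1 := by
        rw [h2, smul_smul] at hc
        exact (smul_left_injective F (hmul0 hx hx0 hy0) (by simpa using hc)).symm
      rw [mul_assoc, hc, mul_smul_comm, ← mul_assoc, hc, smul_mul_assoc, smul_smul, h3, one_smul,
        mul_assoc]
  let T : Subgroup G :=
    { carrier := {g | Γ g ≠ ⊥}
      one_mem' := (Submodule.ne_bot_iff _).2 ⟨1, hone, one_ne_zero⟩
      mul_mem' := fun {g k} hg hk => by
        obtain ⟨x, hx, hx0⟩ := (Submodule.ne_bot_iff _).1 hg
        obtain ⟨y, hy, hy0⟩ := (Submodule.ne_bot_iff _).1 hk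
        exact (Submodule.ne_bot_iff _).2 ⟨x * y, hmul _ _ _ hx _ hy, hmul0 hx hx0 hy0⟩
      inv_mem' := fun {g} hg => by
        rwa [inv_eq_of_mul_eq_one_right (hsq g hg)] }
  have hT : IsGradedDivInv φ Γ T τ :=
    ⟨hint, hone, fun hx hy => hmul _ _ _ hx _ hy, inferInstance,
      fun hx hx0 => hunit _ _ hx hx0, fun _ => Iff.rfl,
      fun hx hy hx0 => exists_smul_of_isUnit hunit hx hy hx0, hinv, hinv_mul,
      fun _ hx => hτ _ _ hx⟩
  refine ⟨T, τ, hT, hsq, fun s hs hpol hτs => ?_⟩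
  obtain ⟨x, hx, hx0⟩ := hT.exists_mem_ne_zero hs
  refine hcentral hx hx0 (by rw [hτ s x hx, hτs, one_smul]) fun k y hy => ?_
  by_cases hk : k ∈ T
  · rw [hT.mul_comm_smul hs hk hx hy, hpol k hk, one_smul]
  · simp [hT.eq_zero_of_notMem hk hy]

end structure_theory

section subgroups

omit [DecidableEq G]

theorem exists_complement_zpowers {T : Subgroup G} [Finite T] (hT : ∀ s ∈ T, s * s = 1) {t : G}
    (ht : t ∈ T) (ht1 : t ≠ 1) : ∃ T₀ ≤ T, t ∉ T₀ ∧ ∀ s ∈ T, s ∈ T₀ ∨ s * t ∈ T₀ := by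
  obtain ⟨P, hP⟩ := (Set.toFinite {P : Subgroup T | ⟨t, ht⟩ ∉ P}).exists_maximal
    ⟨⊥, fun h => ht1 (congrArg Subtype.val (Subgroup.mem_bot.1 h))⟩
  refine ⟨P.map T.subtype, Subgroup.map_subtype_le P, ?_, fun s hs => ?_⟩
  · rintro ⟨u, hu, rfl⟩
    exact hP.prop hu
  · by_cases hsP : (⟨s, hs⟩ : T) ∈ P
    · exact Or.inl ⟨_, hsP, rfl⟩
    · have hmem : (⟨t, ht⟩ : T) ∈ P ⊔ Subgroup.zpowers ⟨s, hs⟩ := by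
        by_contra hn
        exact hsP (hP.le_of_ge hn le_sup_left
          (Subgroup.mem_sup_right (Subgroup.mem_zpowers _)))
      rw [IsGradedDivInv.mem_sup_zpowers (Subtype.ext (hT s hs))] at hmem
      rcases hmem with h | h
      · exact absurd h hP.prop
      · exact Or.inr ⟨_, h, mul_comm t s⟩

theorem exists_natCard_eq_two_pow {T : Subgroup G} [Finite T] (hT : ∀ s ∈ T, s * s = 1) {n : ℕ}
    (hn : Nat.card T = n * n) : ∃ m : ℕ, Nat.card T = 2 ^ (2 * m) := by
  have hp : IsPGroup 2 T := fun s => ⟨1, Subtype.ext (by simpa [pow_two] using hT s s.2)⟩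
  obtain ⟨k, hk⟩ := IsPGroup.iff_card.1 hp
  obtain ⟨m, -, rfl⟩ := (Nat.dvd_prime_pow Nat.prime_two).1 (hk ▸ hn ▸ Dvd.intro n rfl : n ∣ 2 ^ k)
  exact ⟨m, by rw [hn, two_mul, pow_add]⟩

end subgroups

section exchange

variable {T : Subgroup G} {β : G → G → F} {τ : G → F} {t : G}

omit [DecidableEq G] in
theorem eq_one_of_polar (hq : QuadData F G T β τ) {u : G} (hu : u ∈ T)
    (h : ∀ v ∈ T, polar τ u v = 1) : u = 1 :=
  hq.2.2.2.2.2 u hu fun v hv => (hq.2.1 u hu v hv).trans (h v hv)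

omit [DecidableEq G] in
theorem projT_mem (ht : t * t = 1) {s : G} (hs : s ∈ T ⊔ Subgroup.zpowers t) :
    projT G T t s ∈ T := by
  rw [projT]
  split_ifs with h
  · exact h
  · exact ((IsGradedDivInv.mem_sup_zpowers ht).1 hs).resolve_left h

omit [DecidableEq G] in
theorem betaExt_eq_polar_tauExt (hq : QuadData F G T β τ) (ht : t * t = 1) {s s' : G}
    (hs : s ∈ T ⊔ Subgroup.zpowers t) (hs' : s' ∈ T ⊔ Subgroup.zpowers t) :
    betaExt F G T t β s s' = polar (tauExt F G T t τ) s s' := by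
  have hp := projT_mem ht hs
  have hp' := projT_mem ht hs'
  rw [betaExt, hq.2.1 _ hp _ hp', polar]
  by_cases h : s ∈ T <;> by_cases h' : s' ∈ T
  · simp only [projT, h, h', if_true, tauExt_of_mem, T.mul_mem h h']
  · have hm : s * s' ∉ T := fun hm => h' ((T.mul_mem_cancel_left h).1 hm)
    simp only [projT, h, h', if_true, if_false, tauExt_of_mem h, tauExt_of_notMem h',
      tauExt_of_notMem hm, mul_assoc]
    ring
  · have hm : s * s' ∉ T := fun hm => h ((T.mul_mem_cancel_right h').1 hm)
    simp only [projT, h, h', if_true, if_false, tauExt_of_mem h', tauExt_of_notMem h,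
      tauExt_of_notMem hm, mul_assoc, mul_comm t s']
    ring
  · have hmul : s * t * (s' * t) = s * s' := by
      rw [mul_mul_mul_comm, ht, mul_one]
    simp only [projT, h, h', if_false] at hp hp' ⊢
    have hm : s * s' ∈ T := hmul ▸ T.mul_mem hp hp'
    rw [tauExt_of_mem hm, tauExt_of_notMem h, tauExt_of_notMem h', hmul]
    ring

namespace IsGradedDivInv

variable {A : Type*} [Ring A] [Algebra F A] {φ : A →ₗ[F] A} {Γ : G → Submodule F A}

theorem finite_support (h : IsGradedDivInv φ Γ T τ) : Finite T := by
  have := h.nontrivial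
  have := h.finite
  obtain ⟨b, -⟩ := h.exists_basis
  exact Module.Finite.finite_basis b

theorem polar_one_left (h : IsGradedDivInv φ Γ T τ) {v : G} (hv : v ∈ T) : polar τ 1 v = 1 := by
  rw [polar, one_mul, h.tau_one, mul_one, h.tau_mul_self hv]

theorem polar_tauExt_left (h : IsGradedDivInv φ Γ T τ) (hq : QuadData F G T β τ) (htT : t ∉ T)
    (ht : t * t = 1) {s : G} (hs : s ∈ T ⊔ Subgroup.zpowers t) :
    polar (tauExt F G T t τ) t s = 1 := by
  have htt : t ∈ T ⊔ Subgroup.zpowers t := Subgroup.mem_sup_right (Subgroup.mem_zpowers t)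
  have hp := projT_mem ht hs
  have h1 : projT G T t t = 1 := by rw [projT, if_neg htT, ht]
  rw [← betaExt_eq_polar_tauExt hq ht htt hs, betaExt, h1, hq.2.1 _ T.one_mem _ hp]
  exact h.polar_one_left hp

omit [DecidableEq G] in
theorem eq_one_or_eq_of_polar_tauExt (hq : QuadData F G T β τ) (ht : t * t = 1) {u : G}
    (hu : u ∈ T ⊔ Subgroup.zpowers t)
    (h : ∀ s ∈ T ⊔ Subgroup.zpowers t, polar (tauExt F G T t τ) u s = 1) : u = 1 ∨ u = t := by
  have h1 : projT G T t u = 1 := by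
    refine hq.2.2.2.2.2 _ (projT_mem ht hu) fun v hv => ?_
    have hv' : v ∈ T ⊔ Subgroup.zpowers t := Subgroup.mem_sup_left hv
    have := h v hv'
    rwa [← betaExt_eq_polar_tauExt hq ht hu hv', betaExt,
      show projT G T t v = v from if_pos hv] at this
  by_cases huT : u ∈ T
  · rw [projT, if_pos huT] at h1
    exact Or.inl h1
  · rw [projT, if_neg huT] at h1
    exact Or.inr (mul_right_cancel (h1.trans ht.symm))

theorem exchange_eq_bot_or_eq_top (h : IsGradedDivInv φ Γ T τ)
    (hn : ∀ u ∈ T, (∀ v ∈ T, polar τ u v = 1) → u = 1) (I : Submodule F (A × Aᵐᵒᵖ))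
    (hI : ∀ a : A × Aᵐᵒᵖ, ∀ x ∈ I, a * x ∈ I ∧ x * a ∈ I)
    (hIinv : ∀ x ∈ I, exInvG F A x ∈ I) : I = ⊥ ∨ I = ⊤ := by
  have hfst : ∀ p ∈ I, (p.1, 0) ∈ I := fun p hp => by
    simpa [Prod.mul_def] using (hI (1, 0) p hp).1
  have hsnd : ∀ p ∈ I, (p.2.unop, 0) ∈ I := fun p hp => hfst _ (hIinv p hp)
  rcases h.eq_bot_or_eq_top hn (I.comap (LinearMap.inl F A Aᵐᵒᵖ)) (fun a x hx => by
    simpa [Prod.mul_def] using hI (a, 0) _ hx) with h0 | h1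
  · left
    have h0' : ∀ x, (x, 0) ∈ I → x = 0 := fun x hx => by
      have : x ∈ I.comap (LinearMap.inl F A Aᵐᵒᵖ) := hx
      rwa [h0] at this
    refine (Submodule.eq_bot_iff _).2 fun p hp => Prod.ext (h0' _ (hfst p hp)) ?_
    exact MulOpposite.unop_injective (h0' _ (hsnd p hp))
  · right
    have h1' : ∀ x, (x, 0) ∈ I := fun x => by
      have : x ∈ I.comap (LinearMap.inl F A Aᵐᵒᵖ) := h1 ▸ Submodule.mem_top
      exact this
    refine Submodule.eq_top_iff'.2 fun p => ?_
    have := I.add_mem (h1' p.1) (hIinv _ (h1' p.2.unop))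
    simpa [exInvG_apply] using this

omit [DecidableEq G] in
theorem exists_ideal_prod [Nontrivial A] : ∃ K : Submodule F (A × Aᵐᵒᵖ),
    (∀ a : A × Aᵐᵒᵖ, ∀ x ∈ K, a * x ∈ K ∧ x * a ∈ K) ∧ K ≠ ⊥ ∧ K ≠ ⊤ := by
  refine ⟨LinearMap.ker (LinearMap.snd F A Aᵐᵒᵖ), fun a x hx => ?_, fun h0 => ?_, fun h1 => ?_⟩
  · simp only [LinearMap.mem_ker, LinearMap.snd_apply] at hx
    simp [hx]
  · have : ((1, 0) : A × Aᵐᵒᵖ) ∈ (⊥ : Submodule F (A × Aᵐᵒᵖ)) := h0 ▸ rfl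
    simp at this
  · have : ((0, 1) : A × Aᵐᵒᵖ) ∈ LinearMap.ker (LinearMap.snd F A Aᵐᵒᵖ) :=
      h1 ▸ Submodule.mem_top
    simp at this

/-- If the polar form of `τ` is degenerate but `τ` takes the value `-1` on the nontrivial part
of its radical, then the radical is generated by one element and has a complement on which the
polar form is nondegenerate. -/
theorem exists_radical_complement (h : IsGradedDivInv φ Γ T τ) (hT : ∀ s ∈ T, s * s = 1)
    (hrad : ∀ s ∈ T, (∀ v ∈ T, polar τ s v = 1) → τ s = 1 → s = 1)
    (hdeg : ¬ ∀ u ∈ T, (∀ v ∈ T, polar τ u v = 1) → u = 1) :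
    ∃ t ∈ T, t ≠ 1 ∧ ∃ T₀ ≤ T, t ∉ T₀ ∧ T₀ ⊔ Subgroup.zpowers t = T ∧
      (∀ u ∈ T₀, (∀ v ∈ T₀, polar τ u v = 1) → u = 1) ∧
      ∀ s ∈ T, tauExt F G T₀ t τ s = τ s := by
  push Not at hdeg
  obtain ⟨t, htT, htpol, ht1⟩ := hdeg
  have := h.finite_support
  have htt := hT t htT
  have hτt : τ t = -1 := (h.tau_eq htT).resolve_left fun h1 => ht1 (hrad t htT htpol h1)
  have hτmul : ∀ s ∈ T, -τ (s * t) = τ s := fun s hs => by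
    have h1 := htpol s hs
    have h2 := h.tau_mul_self hs
    rw [polar, hτt, mul_comm t] at h1
    linear_combination τ s * h1 + τ (s * t) * h2
  obtain ⟨T₀, hT₀, htT₀, hcompl⟩ := exists_complement_zpowers hT htT ht1
  refine ⟨t, htT, ht1, T₀, hT₀, htT₀, le_antisymm ?_ fun s hs => ?_, fun u hu hpol => ?_,
    fun s hs => ?_⟩
  · exact sup_le hT₀ (by simpa using htT)
  · exact (mem_sup_zpowers htt).2 (hcompl s hs)
  · have huT := hT₀ hu
    have hpol' : ∀ v ∈ T, polar τ u v = 1 := fun v hv => by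
      rcases hcompl v hv with hv' | hv'
      · exact hpol v hv'
      · have h1 := hpol _ hv'
        rwa [h.polar_mul_right huT hv htT, polar_comm τ u t, htpol u huT, mul_one] at h1
    by_contra hu1
    have hτu : τ u = -1 := (h.tau_eq huT).resolve_left fun h1 => hu1 (hrad u huT hpol' h1)
    have hut : u * t = 1 := by
      refine hrad _ (T.mul_mem huT htT) (fun v hv => ?_) ?_
      · rw [h.polar_mul_left huT htT hv, hpol' v hv, htpol v hv, mul_one]
      · rw [← neg_neg (τ (u * t)), hτmul u huT, hτu, neg_neg]
    exact htT₀ ((mul_right_cancel (hut.trans htt.symm) : u = t) ▸ hu)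
  · by_cases hs₀ : s ∈ T₀
    · exact tauExt_of_mem hs₀
    · rw [tauExt_of_notMem hs₀, hτmul s hs]

end IsGradedDivInv

end exchange

end GradedDivInv

/-!
STATEMENT 16.  (1) For every elementary 2-subgroup T of G of rank 2m, every order-2 element
t ∈ G∖T, and every quadratic form τ : T → F with nondegenerate alternating polar form β,
D_inv(T,β,τ)^ex_t is a G-graded graded-division algebra with involution which is simple as an
algebra with involution but whose underlying algebra is not simple.  (2) Conversely, every
G-graded graded-division algebra with involution which is simple as an algebra with involution
and whose underlying algebra is not simple is isomorphic to such a D_inv(T,β,τ)^ex_t.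
(3) D_inv(T₁,β₁,τ₁)^ex_{t₁} ≅ D_inv(T₂,β₂,τ₂)^ex_{t₂} iff T₁⟨t₁⟩ = T₂⟨t₂⟩, t₁ = t₂,
β₁^[t₁] = β₂^[t₂] and τ₁^[t₁] = τ₂^[t₂].  (F algebraically closed, char F ≠ 2.)
-/

theorem stmt_16
    (F : Type u) [Field F] [IsAlgClosed F] (hchar : ringChar F ≠ 2)
    (G : Type v) [CommGroup G] [DecidableEq G] :
    -- (1) each D_inv(T,β,τ)^ex_t is a graded-division algebra with involution, simple as an
    --     algebra with involution, with non-simple underlying algebra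
    (∀ (T : Subgroup G), (∀ s ∈ T, s * s = 1) → ∀ m : ℕ, Nat.card T = 2 ^ (2 * m) →
      ∀ t : G, t ∉ T → t * t = 1 → t ≠ 1 →
      ∀ (β : G → G → F) (τ : G → F), QuadData F G T β τ →
      ∀ (D : Type w) [Ring D] [Algebra F D],
      ∀ (φ₀ : D →ₗ[F] D) (Dgr : G → Submodule F D) (X : G → D),
      IsDinv F G D φ₀ Dgr X T β τ →
      -- the exchange grading is a G-grading of D ⊕ D^op ...
      (DirectSum.IsInternal (exGrT F G φ₀ Dgr t) ∧
       ((1 : D × Dᵐᵒᵖ) ∈ exGrT F G φ₀ Dgr t 1) ∧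
       (∀ g h : G, ∀ x ∈ exGrT F G φ₀ Dgr t g, ∀ y ∈ exGrT F G φ₀ Dgr t h,
          x * y ∈ exGrT F G φ₀ Dgr t (g * h)) ∧
       -- ... making it a graded-division algebra ...
       (∀ h : G, ∀ x ∈ exGrT F G φ₀ Dgr t h, x ≠ 0 → IsUnit x) ∧
       -- ... with involution the exchange involution (preserving the components) ...
       (∀ x y : D × Dᵐᵒᵖ, exInvG F D (x * y) = exInvG F D y * exInvG F D x) ∧
       (∀ x : D × Dᵐᵒᵖ, exInvG F D (exInvG F D x) = x) ∧
       (∀ h : G, ∀ x ∈ exGrT F G φ₀ Dgr t h, exInvG F D x ∈ exGrT F G φ₀ Dgr t h) ∧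
       -- ... simple as an algebra with involution ...
       (∃ a b : D × Dᵐᵒᵖ, a * b ≠ 0) ∧
       (∀ I : Submodule F (D × Dᵐᵒᵖ),
          (∀ a : D × Dᵐᵒᵖ, ∀ x ∈ I, a * x ∈ I ∧ x * a ∈ I) →
          (∀ x ∈ I, exInvG F D x ∈ I) → I = ⊥ ∨ I = ⊤) ∧
       -- ... but with non-simple underlying algebra
       (∃ K : Submodule F (D × Dᵐᵒᵖ),
          (∀ a : D × Dᵐᵒᵖ, ∀ x ∈ K, a * x ∈ K ∧ x * a ∈ K) ∧ K ≠ ⊥ ∧ K ≠ ⊤))) ∧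
    -- (2) conversely, every such algebra is isomorphic to some D_inv(T,β,τ)^ex_t
    (∀ (Dc : Type w) [Ring Dc] [Algebra F Dc],
      ∀ (φc : Dc →ₗ[F] Dc) (Γc : G → Submodule F Dc),
      -- a G-graded graded-division algebra ...
      DirectSum.IsInternal Γc → (1 : Dc) ∈ Γc 1 →
      (∀ g h : G, ∀ x ∈ Γc g, ∀ y ∈ Γc h, x * y ∈ Γc (g * h)) →
      FiniteDimensional F Dc →
      (∀ g : G, ∀ x ∈ Γc g, x ≠ 0 → IsUnit x) →
      -- ... with involution ...
      (∀ a, φc (φc a) = a) → (∀ a b, φc (a * b) = φc b * φc a) →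
      (∀ g : G, ∀ x ∈ Γc g, φc x ∈ Γc g) →
      -- ... simple as an algebra with involution ...
      (∀ I : Submodule F Dc,
        (∀ a : Dc, ∀ x ∈ I, a * x ∈ I ∧ x * a ∈ I) → (∀ x ∈ I, φc x ∈ I) →
        I = ⊥ ∨ I = ⊤) →
      -- ... whose underlying algebra is not simple
      (∃ K : Submodule F Dc,
        (∀ a : Dc, ∀ x ∈ K, a * x ∈ K ∧ x * a ∈ K) ∧ K ≠ ⊥ ∧ K ≠ ⊤) →
      ∃ (T : Subgroup G) (m : ℕ) (t : G) (β : G → G → F) (τ : G → F),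
        (∀ s ∈ T, s * s = 1) ∧ Nat.card T = 2 ^ (2 * m) ∧
        t ∉ T ∧ t * t = 1 ∧ t ≠ 1 ∧ QuadData F G T β τ ∧
        ∃ E : DinvData.{u, v, w} F G, IsDinv F G E.carrier E.inv E.gr E.X T β τ ∧
          ∃ e : Dc ≃ₐ[F] (E.carrier × E.carrierᵐᵒᵖ),
            (∀ x : Dc, e (φc x) = exInvG F E.carrier (e x)) ∧
            (∀ h : G,
              Submodule.map (e : Dc →ₗ[F] (E.carrier × E.carrierᵐᵒᵖ)) (Γc h)
                = exGrT F G E.inv E.gr t h)) ∧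
    -- (3) the isomorphism condition
    (∀ (T₁ T₂ : Subgroup G), (∀ s ∈ T₁, s * s = 1) → (∀ s ∈ T₂, s * s = 1) →
      ∀ (m₁ m₂ : ℕ), Nat.card T₁ = 2 ^ (2 * m₁) → Nat.card T₂ = 2 ^ (2 * m₂) →
      ∀ (t₁ t₂ : G), t₁ ∉ T₁ → t₂ ∉ T₂ → t₁ * t₁ = 1 → t₁ ≠ 1 → t₂ * t₂ = 1 → t₂ ≠ 1 →
      ∀ (β₁ β₂ : G → G → F) (τ₁ τ₂ : G → F),
      QuadData F G T₁ β₁ τ₁ → QuadData F G T₂ β₂ τ₂ →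
      ∀ (D₁ : Type w) [Ring D₁] [Algebra F D₁],
      ∀ (φ₁ : D₁ →ₗ[F] D₁) (Dgr₁ : G → Submodule F D₁) (X₁ : G → D₁),
      IsDinv F G D₁ φ₁ Dgr₁ X₁ T₁ β₁ τ₁ →
      ∀ (D₂ : Type w) [Ring D₂] [Algebra F D₂],
      ∀ (φ₂ : D₂ →ₗ[F] D₂) (Dgr₂ : G → Submodule F D₂) (X₂ : G → D₂),
      IsDinv F G D₂ φ₂ Dgr₂ X₂ T₂ β₂ τ₂ →
      ((∃ e : (D₁ × D₁ᵐᵒᵖ) ≃ₐ[F] (D₂ × D₂ᵐᵒᵖ),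
          (∀ x : D₁ × D₁ᵐᵒᵖ, e (exInvG F D₁ x) = exInvG F D₂ (e x)) ∧
          (∀ h : G,
            Submodule.map (e : (D₁ × D₁ᵐᵒᵖ) →ₗ[F] (D₂ × D₂ᵐᵒᵖ)) (exGrT F G φ₁ Dgr₁ t₁ h)
              = exGrT F G φ₂ Dgr₂ t₂ h)) ↔
        (T₁ ⊔ Subgroup.zpowers t₁ = T₂ ⊔ Subgroup.zpowers t₂ ∧ t₁ = t₂ ∧
          (∀ s ∈ T₁ ⊔ Subgroup.zpowers t₁, ∀ s' ∈ T₁ ⊔ Subgroup.zpowers t₁,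
            betaExt F G T₁ t₁ β₁ s s' = betaExt F G T₂ t₂ β₂ s s') ∧
          (∀ s ∈ T₁ ⊔ Subgroup.zpowers t₁,
            tauExt F G T₁ t₁ τ₁ s = tauExt F G T₂ t₂ τ₂ s)))) := by
  have h2 : (2 : F) ≠ 0 := Ring.two_ne_zero hchar
  refine ⟨?_, ?_, ?_⟩
  · intro T hT m hm t htT htt ht1 β τ hq D _ _ φ₀ Dgr X hD
    have h := hD.isGradedDivInv
    have hx := h.exchange h2 htT htt
    have := h.nontrivial
    exact ⟨hx.internal, hx.one_mem, fun g k x hx' y hy => hx.mul_mem hx' hy,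
      fun g x hx' hx0 => hx.isUnit hx' hx0, hx.inv_mul, hx.inv_inv, fun g x hx' => hx.inv_mem hx',
      ⟨1, 1, by simp⟩,
      fun I hI hIinv =>
        h.exchange_eq_bot_or_eq_top (fun u hu => GradedDivInv.eq_one_of_polar hq hu) I hI hIinv,
      GradedDivInv.IsGradedDivInv.exists_ideal_prod⟩
  · intro A _ _ φ Γ hint hone hmul hfin hunit hinv hinv_mul hφΓ hsimple hK
    obtain ⟨K, hK, hK0, hK1⟩ := hK
    have : Nontrivial A := by
      obtain ⟨x, -, hx0⟩ := (Submodule.ne_bot_iff _).1 hK0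
      exact nontrivial_of_ne x 0 hx0
    obtain ⟨T, τ, h, hT, hrad⟩ := GradedDivInv.exists_isGradedDivInv hint hone hmul hunit hinv
      hinv_mul hφΓ hsimple
    obtain ⟨t, htT, ht1, T₀, hT₀, htT₀, hsup, hn, hτ⟩ := h.exists_radical_complement hT hrad
      fun hn => (h.eq_bot_or_eq_top hn K hK).elim hK0 hK1
    have htt := hT t htT
    have hT₀2 : ∀ s ∈ T₀, s * s = 1 := fun s hs => hT s (hT₀ hs)
    obtain ⟨S, φ₀, Γ₀, h₀⟩ := h.exists_restrict hT hT₀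
    obtain ⟨X, hX⟩ := h₀.exists_isDinv
    obtain ⟨n, hcard⟩ := h₀.natCard_eq_sq hn
    have : Finite T₀ := h₀.finite_support
    obtain ⟨m, hm⟩ := GradedDivInv.exists_natCard_eq_two_pow hT₀2 hcard
    have hex := h₀.exchange h2 htT₀ htt
    rw [hsup] at hex
    obtain ⟨e, he, heΓ⟩ := h.exists_algEquiv hex fun s hs => (hτ s hs).symm
    exact ⟨T₀, m, t, GradedDivInv.polar τ, τ, hT₀2, hm, htT₀, htt, ht1, h₀.quadData hn,
      ⟨S, φ₀, Γ₀, X⟩, hX, e, he, heΓ⟩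
  · intro T₁ T₂ _ _ _ _ _ _ t₁ t₂ ht₁T ht₂T ht₁ ht₁1 ht₂ ht₂1 β₁ β₂ τ₁ τ₂ hq₁ hq₂
      D₁ _ _ φ₁ Dgr₁ X₁ hD₁ D₂ _ _ φ₂ Dgr₂ X₂ hD₂
    have h₁ := hD₁.isGradedDivInv
    have hx₁ := h₁.exchange h2 ht₁T ht₁
    have hx₂ := hD₂.isGradedDivInv.exchange h2 ht₂T ht₂
    constructor
    · rintro ⟨e, he, heΓ⟩
      obtain ⟨hT, hτ⟩ := hx₁.eq_of_algEquiv hx₂ e he heΓ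
      have hpol : ∀ s ∈ T₁ ⊔ Subgroup.zpowers t₁, ∀ s' ∈ T₁ ⊔ Subgroup.zpowers t₁,
          GradedDivInv.polar (tauExt F G T₁ t₁ τ₁) s s'
            = GradedDivInv.polar (tauExt F G T₂ t₂ τ₂) s s' := fun s hs s' hs' => by
        simp only [GradedDivInv.polar, hτ s hs, hτ s' hs', hτ _ (Subgroup.mul_mem _ hs hs')]
      have ht₁s : t₁ ∈ T₁ ⊔ Subgroup.zpowers t₁ :=
        Subgroup.mem_sup_right (Subgroup.mem_zpowers t₁)
      refine ⟨hT, ?_, fun s hs s' hs' => ?_, hτ⟩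
      · refine (GradedDivInv.IsGradedDivInv.eq_one_or_eq_of_polar_tauExt hq₂ ht₂ (hT ▸ ht₁s)
          fun s hs => ?_).resolve_left ht₁1
        rw [← hT] at hs
        rw [← hpol t₁ ht₁s s hs, h₁.polar_tauExt_left hq₁ ht₁T ht₁ hs]
      · rw [GradedDivInv.betaExt_eq_polar_tauExt hq₁ ht₁ hs hs', hpol s hs s' hs',
          GradedDivInv.betaExt_eq_polar_tauExt hq₂ ht₂ (hT ▸ hs) (hT ▸ hs')]
    · rintro ⟨hT, -, -, hτ⟩
      rw [← hT] at hx₂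
      exact hx₁.exists_algEquiv hx₂ hτ
end

section
/- Let F be an algebraically closed field of characteristic different from 2 and G an abelian group. Let T₁, T₂ be elementary 2-subgroups of G, let t_i ∈ G∖T_i (i=1,2) be order-2 elements, and let τ₁: T₁ → F, τ₂: T₂ → F be quadratic forms whose polar forms β₁, β₂ are nondegenerate alternating bicharacters. Then there exists a homogeneous element d of D_inv(T₁,β₁,τ₁)^ex_{t₁} such that D_inv(T₁,β₁,τ₁,d)^ex_{t₁} ≅ D_inv(T₂,β₂,τ₂)^ex_{t₂} if and only if T₁⟨t₁⟩ = T₂⟨t₂⟩, t₁ = t₂ and β₁^{[t₁]} = β₂^{[t₂]}. -/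
universe u v w

open scoped TensorProduct

/-- Over an algebraically closed field, a nonzero finite-dimensional commutative algebra
has a character. -/
lemma exists_algHom_of_finiteDimensional (F : Type*) [Field F] [IsAlgClosed F]
    (C : Type*) [CommRing C] [Algebra F C] [Nontrivial C] [FiniteDimensional F C] :
    Nonempty (C →ₐ[F] F) := by
  obtain ⟨m, hm⟩ := Ideal.exists_maximal C
  let : Field (C ⧸ m) := Ideal.Quotient.field m
  have : Module.Finite F (C ⧸ m) :=
    Module.Finite.of_surjective (Ideal.Quotient.mkₐ F m).toLinearMap
      (Ideal.Quotient.mkₐ_surjective F m)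
  exact ⟨(IsAlgClosed.lift : (C ⧸ m) →ₐ[F] F).comp (Ideal.Quotient.mkₐ F m)⟩

open scoped IsMulCommutative in
/-- A commuting family of units that is multiplicative up to scalars admits a compatible
family of nonzero scalars. -/
lemma exists_scalars_of_commute {F : Type*} [Field F] [IsAlgClosed F] {A S : Type*} [Ring A]
    [Algebra F A] [Nontrivial A] [FiniteDimensional F A] [Group S] (W : S → Aˣ)
    (hcomm : ∀ u v, (W u : A) * W v = W v * W u)
    (hmul : ∀ u v, ∃ k : F, (W u : A) * W v = k • (W (u * v) : A)) :
    ∃ c : S → F, (∀ u, c u ≠ 0) ∧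
      ∀ u v (k : F), (W u : A) * W v = k • (W (u * v) : A) → c u * c v = k * c (u * v) := by
  have := Algebra.isMulCommutative_adjoin F (s := Set.range fun u => (W u : A))
    (by rintro _ ⟨u, rfl⟩ _ ⟨v, rfl⟩; exact hcomm u v)
  obtain ⟨χ⟩ := exists_algHom_of_finiteDimensional F
    (Algebra.adjoin F (Set.range fun u => (W u : A)))
  let w (u : S) : Algebra.adjoin F (Set.range fun u => (W u : A)) :=
    ⟨W u, Algebra.subset_adjoin ⟨u, rfl⟩⟩
  have key (u v : S) (k : F) (h : (W u : A) * W v = k • (W (u * v) : A)) :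
      χ (w u) * χ (w v) = k * χ (w (u * v)) := by
    have : w u * w v = k • w (u * v) := Subtype.ext h
    rw [← map_mul, this, map_smul, smul_eq_mul]
  refine ⟨fun u => χ (w u), fun u (hu : χ (w u) = 0) => ?_, key⟩
  obtain ⟨k₁, h₁⟩ := hmul 1 1
  obtain ⟨k, hk⟩ := hmul u u⁻¹
  have hW1 : (W 1 : A) = k₁ • (1 : A) := by
    rw [mul_one] at h₁
    exact (W 1).isUnit.mul_left_cancel (by rw [h₁, mul_smul_comm, mul_one])
  have hw1 : w 1 = k₁ • 1 := Subtype.ext hW1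
  have h0 : k * k₁ = 0 := by
    have := key u u⁻¹ k hk
    rw [hu, mul_inv_cancel, hw1, map_smul, map_one] at this
    simpa using this.symm
  rw [mul_inv_cancel, hW1, smul_smul, h0, zero_smul, ← Units.val_mul] at hk
  exact (W u * W u⁻¹).ne_zero hk

/-- Two algebras with bases of units indexed by the same group, multiplicative up to scalars and
with the same commutation factors, are isomorphic via a map that is diagonal in these bases. -/
lemma exists_algEquiv_of_twisted {F : Type*} [Field F] [IsAlgClosed F] {S : Type*} [CommGroup S]
    {E₁ E₂ : Type*} [Ring E₁] [Algebra F E₁] [FiniteDimensional F E₁]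
    [Ring E₂] [Algebra F E₂] [FiniteDimensional F E₂]
    (Z₁ : Module.Basis S F E₁) (Z₂ : Module.Basis S F E₂)
    (hu₁ : ∀ s, IsUnit (Z₁ s)) (hu₂ : ∀ s, IsUnit (Z₂ s))
    (hm₁ : ∀ s s', ∃ k : F, Z₁ s * Z₁ s' = k • Z₁ (s * s'))
    (hm₂ : ∀ s s', ∃ k : F, Z₂ s * Z₂ s' = k • Z₂ (s * s'))
    (β : S → S → F) (hc₁ : ∀ s s', Z₁ s * Z₁ s' = β s s' • (Z₁ s' * Z₁ s))
    (hc₂ : ∀ s s', Z₂ s * Z₂ s' = β s s' • (Z₂ s' * Z₂ s)) :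
    ∃ (e : E₁ ≃ₐ[F] E₂) (c : S → F), (∀ s, c s ≠ 0) ∧ ∀ s, e (Z₁ s) = c s • Z₂ s := by
  have : Nontrivial E₁ := ⟨Z₁ 1, 0, Z₁.ne_zero 1⟩
  have : Nontrivial E₂ := ⟨Z₂ 1, 0, Z₂.ne_zero 1⟩
  have hne (u v : S) (k : F) (h : Z₂ u * Z₂ v = k • Z₂ (u * v)) : k ≠ 0 := by
    rintro rfl
    rw [zero_smul] at h
    exact ((hu₂ u).mul (hu₂ v)).ne_zero h
  choose Y hY using hu₂
  have hβ (s s' : S) : β s s' ≠ 0 := by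
    intro h
    have := hc₂ s s'
    rw [h, zero_smul, ← hY, ← hY, ← Units.val_mul] at this
    exact (Y s * Y s').ne_zero this
  have hinv (u v : S) (k : F) (hk : k ≠ 0) (a : E₂ˣ) (h : (Y u * Y v : E₂) = k • (a : E₂)) :
      ((Y v)⁻¹ : E₂ˣ) * ((Y u)⁻¹ : E₂ˣ) = k⁻¹ • ((a⁻¹ : E₂ˣ) : E₂) := by
    rw [← Units.val_mul, ← mul_inv_rev]
    refine (Y u * Y v).isUnit.mul_left_cancel ?_
    rw [Units.mul_inv, Units.val_mul, h, mul_smul_comm, smul_mul_assoc, smul_smul,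
      inv_mul_cancel₀ hk, one_smul, Units.mul_inv]
  let W (u : S) : (E₁ ⊗[F] E₂ᵐᵒᵖ)ˣ :=
    (hu₁ u).unit.map (Algebra.TensorProduct.includeLeft : E₁ →ₐ[F] E₁ ⊗[F] E₂ᵐᵒᵖ) *
    (Units.opEquiv.symm (MulOpposite.op (Y u)⁻¹)).map
      (Algebra.TensorProduct.includeRight : E₂ᵐᵒᵖ →ₐ[F] E₁ ⊗[F] E₂ᵐᵒᵖ)
  have hW (u : S) : (W u : E₁ ⊗[F] E₂ᵐᵒᵖ) = Z₁ u ⊗ₜ MulOpposite.op (((Y u)⁻¹ : E₂ˣ) : E₂) := by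
    simp only [W, Units.val_mul, Units.coe_map, Units.coe_opEquiv_symm]
    simp
  have hWmul (u v : S) : ((W u : E₁ ⊗[F] E₂ᵐᵒᵖ) * (W v : E₁ ⊗[F] E₂ᵐᵒᵖ)) =
      (Z₁ u * Z₁ v) ⊗ₜ[F] MulOpposite.op (((Y v)⁻¹ : E₂ˣ) * ((Y u)⁻¹ : E₂ˣ) : E₂) := by
    rw [hW, hW, Algebra.TensorProduct.tmul_mul_tmul, MulOpposite.op_mul]
  have hrel (u v : S) (k₁ k₂ : F) (h₁ : Z₁ u * Z₁ v = k₁ • Z₁ (u * v))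
      (h₂ : Z₂ u * Z₂ v = k₂ • Z₂ (u * v)) :
      (W u : E₁ ⊗[F] E₂ᵐᵒᵖ) * W v = (k₁ * k₂⁻¹) • (W (u * v) : E₁ ⊗[F] E₂ᵐᵒᵖ) := by
    rw [hWmul, hW, h₁, hinv u v k₂ (hne u v k₂ h₂) (Y (u * v)) (by rw [hY, hY, hY, h₂]),
      MulOpposite.op_smul, TensorProduct.smul_tmul_smul]
  obtain ⟨c, hc0, hc⟩ := exists_scalars_of_commute (F := F) W
    (fun u v => by
      rw [hWmul, hWmul, hc₁ u v, hinv u v (β u v) (hβ u v) (Y v * Y u)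
        (by rw [Units.val_mul, hY, hY, hc₂]), MulOpposite.op_smul, TensorProduct.smul_tmul_smul,
        mul_inv_cancel₀ (hβ u v), one_smul, mul_inv_rev, Units.val_mul])
    (fun u v => by
      obtain ⟨k₁, h₁⟩ := hm₁ u v
      obtain ⟨k₂, h₂⟩ := hm₂ u v
      exact ⟨_, hrel u v k₁ k₂ h₁ h₂⟩)
  let l : E₁ ≃ₗ[F] E₂ := Z₁.equiv (Z₂.unitsSMul fun s => Units.mk0 (c s) (hc0 s)) (Equiv.refl S)
  have hl (s : S) : l (Z₁ s) = c s • Z₂ s := by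
    simp [l, Module.Basis.unitsSMul_apply, Units.smul_def]
  have hlmul (x y : E₁) : l (x * y) = l x * l y := by
    have : (LinearMap.mul F E₁).compr₂ l.toLinearMap =
        (LinearMap.mul F E₂).compl₁₂ l.toLinearMap l.toLinearMap := by
      refine Z₁.ext fun u => Z₁.ext fun v => ?_
      obtain ⟨k₁, h₁⟩ := hm₁ u v
      obtain ⟨k₂, h₂⟩ := hm₂ u v
      have := hc u v _ (hrel u v k₁ k₂ h₁ h₂)
      have hk := hne u v k₂ h₂
      change l (Z₁ u * Z₁ v) = l (Z₁ u) * l (Z₁ v)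
      rw [hl, hl, h₁, map_smul, hl, smul_mul_smul_comm, h₂, smul_smul, smul_smul, this]
      congr 1
      field_simp
    exact LinearMap.congr_fun₂ this x y
  have hl1 : l 1 = 1 := by
    have h := hlmul (l.symm 1) 1
    rw [mul_one, l.apply_symm_apply, one_mul] at h
    exact h.symm
  exact ⟨AlgEquiv.ofLinearEquiv l hl1 hlmul, c, hc0, hl⟩

/-- A nondegenerate bicharacter on a finite elementary 2-group represents every character. -/
lemma exists_eq_bichar_of_nondegenerate {F : Type*} [Field F] [IsAlgClosed F]
    (hchar : ringChar F ≠ 2) {S : Type*} [CommGroup S] [Finite S] (hS : ∀ s : S, s * s = 1)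
    (β : S → S →* F) (hl : ∀ u v w, β (u * v) w = β u w * β v w)
    (hnd : ∀ u, (∀ v, β u v = 1) → u = 1) (χ : S →* F) : ∃ r, ∀ s, β r s = χ s := by
  have h2 : (2 : F) ≠ 0 := Ring.two_ne_zero hchar
  have : NeZero (Monoid.exponent S : F) := ⟨by
    have hd : Monoid.exponent S ∣ 2 :=
      Monoid.exponent_dvd_of_forall_pow_eq_one fun s => by rw [pow_two, hS]
    rcases (Nat.dvd_prime Nat.prime_two).1 hd with h | h <;> simp [h, h2]⟩
  let f : S →* (S →* Fˣ) := MonoidHom.mk' (fun u => (β u).toHomUnits)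
    fun u v => MonoidHom.ext fun w => Units.ext (hl u v w)
  have hf : Function.Injective f := (injective_iff_map_eq_one f).2 fun u hu =>
    hnd u fun v => congrArg Units.val (DFunLike.congr_fun hu v)
  have hcard := CommGroup.card_monoidHom_of_hasEnoughRootsOfUnity S F
  have : Finite (S →* Fˣ) := Nat.finite_of_card_ne_zero (hcard ▸ Nat.card_pos.ne')
  obtain ⟨r, hr⟩ := ((Nat.bijective_iff_injective_and_card f).2 ⟨hf, hcard.symm⟩).2 χ.toHomUnits
  exact ⟨r, fun s => congrArg Units.val (DFunLike.congr_fun hr s)⟩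

section extension

variable {F : Type u} [Field F] {G : Type v} [CommGroup G] {T : Subgroup G} {t : G}

lemma projT_of_mem {s : G} (hs : s ∈ T) : projT G T t s = s := by simp [projT, hs]

lemma projT_of_notMem {s : G} (hs : s ∉ T) : projT G T t s = s * t := by simp [projT, hs]

lemma tauExt_of_mem_s17 {τ : G → F} {s : G} (hs : s ∈ T) : tauExt F G T t τ s = τ s := by
  simp [tauExt, hs]

lemma tauExt_of_notMem_s17 {τ : G → F} {s : G} (hs : s ∉ T) :
    tauExt F G T t τ s = -τ (s * t) := by
  simp [tauExt, hs]

lemma mem_sup_zpowers_iff (hto : t * t = 1) {s : G} :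
    s ∈ T ⊔ Subgroup.zpowers t ↔ s ∈ T ∨ s * t ∈ T := by
  constructor
  · intro h
    obtain ⟨y, hy, z, hz, rfl⟩ := Subgroup.mem_sup.1 h
    obtain ⟨k, rfl⟩ := Subgroup.mem_zpowers_iff.1 hz
    have ht2 : t ^ (2 : ℤ) = 1 := by rw [zpow_two, hto]
    rcases Int.even_or_odd' k with ⟨m, rfl | rfl⟩
    · left; simpa [zpow_mul, ht2] using hy
    · right; simpa [zpow_add, zpow_mul, ht2, mul_assoc, hto] using hy
  · rintro (h | h)
    · exact Subgroup.mem_sup_left h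
    · have : s = s * t * t := by rw [mul_assoc, hto, mul_one]
      rw [this]
      exact Subgroup.mul_mem_sup h (Subgroup.mem_zpowers t)

lemma projT_mem (hto : t * t = 1) {s : G} (hs : s ∈ T ⊔ Subgroup.zpowers t) :
    projT G T t s ∈ T := by
  by_cases h : s ∈ T
  · rwa [projT_of_mem h]
  · rw [projT_of_notMem h]
    exact ((mem_sup_zpowers_iff hto).1 hs).resolve_left h

variable {β : G → G → F} {τ : G → F}

/-- `τ^[t]` is a quadratic form with polar form `β^[t]`, compatibly with the projection. -/
lemma projT_mul_and_polar (hto : t * t = 1) (hq : QuadData F G T β τ) {s s' : G}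
    (hs : s ∈ T ⊔ Subgroup.zpowers t) (hs' : s' ∈ T ⊔ Subgroup.zpowers t) :
    projT G T t (s * s') = projT G T t s * projT G T t s' ∧
    betaExt F G T t β s s' =
      tauExt F G T t τ (s * s') * tauExt F G T t τ s * tauExt F G T t τ s' := by
  have hpol := hq.2.1
  rw [mem_sup_zpowers_iff hto] at hs hs'
  unfold betaExt
  by_cases h : s ∈ T <;> by_cases h' : s' ∈ T
  · have h2 := T.mul_mem h h'
    simp only [projT_of_mem h, projT_of_mem h', projT_of_mem h2, tauExt_of_mem_s17 h,
      tauExt_of_mem_s17 h', tauExt_of_mem_s17 h2, true_and]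
    exact hpol _ h _ h'
  · have h2 : s * s' ∉ T := fun h2 => h' ((T.mul_mem_cancel_left h).1 h2)
    simp only [projT_of_mem h, projT_of_notMem h', projT_of_notMem h2, tauExt_of_mem_s17 h,
      tauExt_of_notMem_s17 h', tauExt_of_notMem_s17 h2, mul_assoc, true_and]
    rw [hpol _ h _ (hs'.resolve_left h')]
    ring
  · have h2 : s * s' ∉ T := fun h2 => h ((T.mul_mem_cancel_right h').1 h2)
    simp only [projT_of_notMem h, projT_of_mem h', projT_of_notMem h2, tauExt_of_notMem_s17 h,
      tauExt_of_mem_s17 h', tauExt_of_notMem_s17 h2, mul_right_comm s s' t, true_and]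
    rw [hpol _ (hs.resolve_left h) _ h']
    ring
  · have hst := hs.resolve_left h
    have hst' := hs'.resolve_left h'
    have e : s * t * (s' * t) = s * s' := by rw [mul_mul_mul_comm, hto, mul_one]
    have h2 : s * s' ∈ T := e ▸ T.mul_mem hst hst'
    simp only [projT_of_notMem h, projT_of_notMem h', projT_of_mem h2, tauExt_of_notMem_s17 h,
      tauExt_of_notMem_s17 h', tauExt_of_mem_s17 h2, e, true_and]
    rw [hpol _ hst _ hst', e]
    ring

lemma tauExt_mul_self (hto : t * t = 1) (hq : QuadData F G T β τ) {s : G}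
    (hs : s ∈ T ⊔ Subgroup.zpowers t) : tauExt F G T t τ s * tauExt F G T t τ s = 1 := by
  by_cases h : s ∈ T
  · rw [tauExt_of_mem_s17 h]
    rcases hq.1 s h with h | h <;> simp [h]
  · rw [tauExt_of_notMem_s17 h]
    rcases hq.1 _ (((mem_sup_zpowers_iff hto).1 hs).resolve_left h) with h | h <;> simp [h]

lemma betaExt_mul_self (hto : t * t = 1) (hq : QuadData F G T β τ) {s s' : G}
    (hs : s ∈ T ⊔ Subgroup.zpowers t) (hs' : s' ∈ T ⊔ Subgroup.zpowers t) :
    betaExt F G T t β s s' * betaExt F G T t β s s' = 1 := by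
  rw [(projT_mul_and_polar hto hq hs hs').2]
  linear_combination (tauExt F G T t τ s * tauExt F G T t τ s) *
    (tauExt F G T t τ s' * tauExt F G T t τ s') * tauExt_mul_self hto hq (mul_mem hs hs') +
    (tauExt F G T t τ s' * tauExt F G T t τ s') * tauExt_mul_self hto hq hs +
    tauExt_mul_self hto hq hs'

lemma QuadData.apply_one (hq : QuadData F G T β τ) : τ 1 = 1 := by
  have h := hq.2.1 1 T.one_mem 1 T.one_mem
  rw [hq.2.2.2.2.1 1 T.one_mem, mul_one] at h
  rcases hq.1 1 T.one_mem with h1 | h1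
  · exact h1
  · rw [h1] at h ⊢
    linear_combination -h

lemma tauExt_self (ht : t ∉ T) (hto : t * t = 1) (hq : QuadData F G T β τ) :
    tauExt F G T t τ t = -1 := by
  rw [tauExt_of_notMem_s17 ht, hto, hq.apply_one]

/-- `t` spans the radical of `β^[t]`. -/
lemma betaExt_radical (hto : t * t = 1) (hq : QuadData F G T β τ) {s : G}
    (hs : s ∈ T ⊔ Subgroup.zpowers t)
    (h : ∀ s' ∈ T ⊔ Subgroup.zpowers t, betaExt F G T t β s s' = 1) : s = 1 ∨ s = t := by
  have hp := hq.2.2.2.2.2 _ (projT_mem hto hs) fun v hv => by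
    simpa [betaExt, projT_of_mem hv] using h v (Subgroup.mem_sup_left hv)
  by_cases hsT : s ∈ T
  · left; rwa [projT_of_mem hsT] at hp
  · right
    rw [projT_of_notMem hsT] at hp
    rw [eq_inv_of_mul_eq_one_left hp, inv_eq_of_mul_eq_one_left hto]

lemma betaExt_self_left (ht : t ∉ T) (hto : t * t = 1) (hq : QuadData F G T β τ) {s : G}
    (hs : s ∈ T ⊔ Subgroup.zpowers t) : betaExt F G T t β t s = 1 := by
  have hp := projT_mem hto hs
  rw [betaExt, projT_of_notMem ht, hto, hq.2.1 1 T.one_mem _ hp, hq.apply_one, one_mul, mul_one]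
  rcases hq.1 _ hp with h | h <;> simp [h]

/-- The homogeneous basis of the twisted exchange double. -/
noncomputable def exBasis {D : Type w} [Ring D] [Algebra F D] (T : Subgroup G) (t : G) (τ : G → F)
    (X : G → D) (s : G) : D × Dᵐᵒᵖ :=
  (X (projT G T t s), MulOpposite.op (tauExt F G T t τ s • X (projT G T t s)))

section

variable [DecidableEq G] {D : Type w} [Ring D] [Algebra F D] {φ₀ : D →ₗ[F] D}
  {Dgr : G → Submodule F D} {X : G → D}

lemma IsDinv.gr_eq_span (hD : IsDinv F G D φ₀ Dgr X T β τ) {u : G} (hu : u ∈ T) :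
    Dgr u = Submodule.span F {X u} := by
  obtain ⟨-, hX, hspan⟩ := hD.2.2.2.2.2.2.1 u hu
  refine le_antisymm (fun x hx => ?_) ((Submodule.span_singleton_le_iff_mem _ _).2 hX)
  obtain ⟨c, rfl⟩ := hspan x hx
  exact Submodule.smul_mem _ c (Submodule.mem_span_singleton_self _)

lemma IsDinv.gr_eq_bot (hD : IsDinv F G D φ₀ Dgr X T β τ) {u : G} (hu : u ∉ T) :
    Dgr u = ⊥ := by
  by_contra h
  exact hu ((hD.2.2.2.2.2.1 u).1 h)

lemma IsDinv.linearIndependent (hD : IsDinv F G D φ₀ Dgr X T β τ) :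
    LinearIndependent F (fun u : T => X u) := by
  refine iSupIndep.linearIndependent (fun u : T => Dgr u)
    (hD.1.submodule_iSupIndep.comp Subtype.val_injective) (fun u => ?_) (fun u => ?_)
  · exact (hD.2.2.2.2.2.2.1 u u.2).2.1
  · exact (hD.2.2.2.2.2.2.1 u u.2).1

lemma IsDinv.span_eq_top (hD : IsDinv F G D φ₀ Dgr X T β τ) :
    ⊤ ≤ Submodule.span F (Set.range fun u : T => X u) := by
  rw [← hD.1.submodule_iSup_eq_top]
  refine iSup_le fun u => ?_
  by_cases hu : u ∈ T
  · rw [hD.gr_eq_span hu]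
    exact Submodule.span_mono (by rintro _ rfl; exact ⟨⟨u, hu⟩, rfl⟩)
  · rw [hD.gr_eq_bot hu]
    exact bot_le

/-- The basis of `D` formed by the elements `X u`, `u ∈ T`. -/
noncomputable def IsDinv.basis (hD : IsDinv F G D φ₀ Dgr X T β τ) : Module.Basis T F D :=
  Module.Basis.mk hD.linearIndependent hD.span_eq_top

lemma IsDinv.basis_apply (hD : IsDinv F G D φ₀ Dgr X T β τ) (u : T) : hD.basis u = X u := by
  simp [IsDinv.basis]

lemma IsDinv.map_X (hD : IsDinv F G D φ₀ Dgr X T β τ) {u : G} (hu : u ∈ T) :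
    φ₀ (X u) = τ u • X u :=
  hD.2.2.2.2.2.2.2.2.2.2 u hu _ (hD.2.2.2.2.2.2.1 u hu).2.1

lemma IsDinv.isUnit_X (hD : IsDinv F G D φ₀ Dgr X T β τ) {u : G} (hu : u ∈ T) :
    IsUnit (X u) :=
  hD.2.2.2.2.1 u _ (hD.2.2.2.2.2.2.1 u hu).2.1 (hD.2.2.2.2.2.2.1 u hu).1

lemma IsDinv.X_mul (hD : IsDinv F G D φ₀ Dgr X T β τ) {u v : G} (hu : u ∈ T) (hv : v ∈ T) :
    ∃ k : F, X u * X v = k • X (u * v) :=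
  (hD.2.2.2.2.2.2.1 _ (T.mul_mem hu hv)).2.2 _
    (hD.2.2.1 u v _ (hD.2.2.2.2.2.2.1 u hu).2.1 _ (hD.2.2.2.2.2.2.1 v hv).2.1)

lemma IsDinv.X_comm (hD : IsDinv F G D φ₀ Dgr X T β τ) {u v : G} (hu : u ∈ T) (hv : v ∈ T) :
    X u * X v = β u v • (X v * X u) :=
  hD.2.2.2.2.2.2.2.1 u hu v hv

lemma exGrT_eq_span (hD : IsDinv F G D φ₀ Dgr X T β τ) (ht : t ∉ T) (hto : t * t = 1) {s : G}
    (hs : s ∈ T ⊔ Subgroup.zpowers t) :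
    exGrT F G φ₀ Dgr t s = Submodule.span F {exBasis T t τ X s} := by
  have hs' := (mem_sup_zpowers_iff hto).1 hs
  unfold exGrT exBasis
  by_cases h : s ∈ T
  · have h2 : s * t ∉ T := fun h2 => ht ((T.mul_mem_cancel_left h).1 h2)
    have e : (Submodule.span F {X s}).prod (⊥ : Submodule F D) =
        Submodule.span F {(X s, (0 : D))} := by
      ext ⟨x, y⟩
      simp [Submodule.mem_prod, Submodule.mem_span_singleton, Prod.ext_iff, eq_comm]
    rw [hD.gr_eq_span h, hD.gr_eq_bot h2, e, Submodule.map_span, Set.image_singleton]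
    simp [projT_of_mem h, tauExt_of_mem_s17 h, hD.map_X h]
  · have hst := hs'.resolve_left h
    have e : (⊥ : Submodule F D).prod (Submodule.span F {X (s * t)}) =
        Submodule.span F {((0 : D), X (s * t))} := by
      ext ⟨x, y⟩
      simp [Submodule.mem_prod, Submodule.mem_span_singleton, Prod.ext_iff, eq_comm]
    rw [hD.gr_eq_span hst, hD.gr_eq_bot h, e, Submodule.map_span, Set.image_singleton]
    simp [projT_of_notMem h, tauExt_of_notMem_s17 h, hD.map_X hst]

lemma exGrT_eq_bot (hD : IsDinv F G D φ₀ Dgr X T β τ) (hto : t * t = 1) {s : G}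
    (hs : s ∉ T ⊔ Subgroup.zpowers t) : exGrT F G φ₀ Dgr t s = ⊥ := by
  rw [mem_sup_zpowers_iff hto, not_or] at hs
  unfold exGrT
  rw [hD.gr_eq_bot hs.1, hD.gr_eq_bot hs.2, Submodule.prod_bot, Submodule.map_bot]

lemma isUnit_exBasis (hD : IsDinv F G D φ₀ Dgr X T β τ) (hto : t * t = 1)
    (hq : QuadData F G T β τ) {s : G} (hs : s ∈ T ⊔ Subgroup.zpowers t) :
    IsUnit (exBasis T t τ X s) := by
  have hX := hD.isUnit_X (projT_mem hto hs)
  have h0 : tauExt F G T t τ s ≠ 0 := left_ne_zero_of_mul_eq_one (tauExt_mul_self hto hq hs)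
  refine Prod.isUnit_iff.2 ⟨hX, ?_⟩
  have : IsUnit (tauExt F G T t τ s • X (projT G T t s)) :=
    (Units.mk0 _ h0 • hX.unit).isUnit
  exact this.op

lemma exBasis_mul (hD : IsDinv F G D φ₀ Dgr X T β τ) (hto : t * t = 1)
    (hq : QuadData F G T β τ) {s s' : G} (hs : s ∈ T ⊔ Subgroup.zpowers t)
    (hs' : s' ∈ T ⊔ Subgroup.zpowers t) :
    ∃ k : F, exBasis T t τ X s * exBasis T t τ X s' = k • exBasis T t τ X (s * s') := by
  obtain ⟨hp, hpol⟩ := projT_mul_and_polar hto hq hs hs'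
  obtain ⟨k, hk⟩ := hD.X_mul (projT_mem hto hs) (projT_mem hto hs')
  have hb := betaExt_mul_self hto hq hs hs'
  have hc := hD.X_comm (projT_mem hto hs) (projT_mem hto hs')
  change _ = betaExt F G T t β s s' • _ at hc
  have hk' : X (projT G T t s') * X (projT G T t s) =
      (betaExt F G T t β s s' * k) • X (projT G T t (s * s')) := by
    rw [hp, mul_smul, ← hk, hc, smul_smul, hb, one_smul]
  refine ⟨k, Prod.ext (by simpa [exBasis, hp] using hk) ?_⟩
  simp only [exBasis, Prod.snd_mul, Prod.smul_snd, ← MulOpposite.op_mul, ← MulOpposite.op_smul]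
  rw [smul_mul_smul_comm, hk', smul_smul, smul_smul]
  congr 2
  rw [hpol]
  linear_combination k * tauExt F G T t τ (s * s') *
    (tauExt F G T t τ s' * tauExt F G T t τ s' * tauExt_mul_self hto hq hs +
      tauExt_mul_self hto hq hs')

lemma exBasis_comm (hD : IsDinv F G D φ₀ Dgr X T β τ) (hto : t * t = 1)
    (hq : QuadData F G T β τ) {s s' : G} (hs : s ∈ T ⊔ Subgroup.zpowers t)
    (hs' : s' ∈ T ⊔ Subgroup.zpowers t) :
    exBasis T t τ X s * exBasis T t τ X s' =
      betaExt F G T t β s s' • (exBasis T t τ X s' * exBasis T t τ X s) := by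
  have hb := betaExt_mul_self hto hq hs hs'
  have hc := hD.X_comm (projT_mem hto hs) (projT_mem hto hs')
  change _ = betaExt F G T t β s s' • _ at hc
  refine Prod.ext (by simpa [exBasis] using hc) ?_
  simp only [exBasis, Prod.snd_mul, Prod.smul_snd, ← MulOpposite.op_mul, ← MulOpposite.op_smul]
  rw [smul_mul_smul_comm, smul_mul_smul_comm, hc, smul_smul, smul_smul]
  congr 2
  linear_combination -(tauExt F G T t τ s' * tauExt F G T t τ s) * hb

omit [DecidableEq G] in
lemma exInvG_exBasis (hto : t * t = 1) (hq : QuadData F G T β τ) {s : G}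
    (hs : s ∈ T ⊔ Subgroup.zpowers t) :
    exInvG F D (exBasis T t τ X s) = tauExt F G T t τ s • exBasis T t τ X s := by
  refine Prod.ext (by simp [exInvG, exBasis]) ?_
  simp [exInvG, exBasis, smul_smul, tauExt_mul_self hto hq hs]

lemma span_exBasis (hchar : ringChar F ≠ 2) (hD : IsDinv F G D φ₀ Dgr X T β τ) (ht : t ∉ T)
    (hto : t * t = 1) (hq : QuadData F G T β τ) :
    ⊤ ≤ Submodule.span F
      (Set.range fun s : (T ⊔ Subgroup.zpowers t : Subgroup G) => exBasis T t τ X s) := by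
  have h2 : (2 : F) ≠ 0 := Ring.two_ne_zero hchar
  set P := Submodule.span F
    (Set.range fun s : (T ⊔ Subgroup.zpowers t : Subgroup G) => exBasis T t τ X s) with hP
  have hmem (s : G) (hs : s ∈ T ⊔ Subgroup.zpowers t) : exBasis T t τ X s ∈ P :=
    Submodule.subset_span ⟨⟨s, hs⟩, rfl⟩
  have hZ (u : T) : (X u, MulOpposite.op (τ u • X u)) ∈ P ∧
      (X u, MulOpposite.op (-τ u • X u)) ∈ P := by
    have hut : (u : G) * t ∉ T := fun h => ht ((T.mul_mem_cancel_left u.2).1 h)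
    have hut' : (u : G) * t * t = u := by rw [mul_assoc, hto, mul_one]
    have h₁ := hmem u (Subgroup.mem_sup_left u.2)
    have h₂ := hmem (u * t) ((mem_sup_zpowers_iff hto).2 (.inr (hut'.symm ▸ u.2)))
    rw [exBasis, projT_of_mem u.2, tauExt_of_mem_s17 u.2] at h₁
    rw [exBasis, projT_of_notMem hut, tauExt_of_notMem_s17 hut, hut'] at h₂
    exact ⟨h₁, h₂⟩
  have hl : (⊤ : Submodule F D) ≤ P.comap (LinearMap.inl F D Dᵐᵒᵖ) := by
    refine hD.span_eq_top.trans (Submodule.span_le.2 ?_)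
    rintro _ ⟨u, rfl⟩
    have := P.smul_mem (2⁻¹ : F) (P.add_mem (hZ u).1 (hZ u).2)
    change (X u, (0 : Dᵐᵒᵖ)) ∈ P
    convert this using 1
    refine Prod.ext ?_ ?_
    · simp [← two_smul F (X u), smul_smul, h2]
    · simp
  have hr : (⊤ : Submodule F D) ≤
      P.comap ((LinearMap.inr F D Dᵐᵒᵖ).comp (MulOpposite.opLinearEquiv F).toLinearMap) := by
    refine hD.span_eq_top.trans (Submodule.span_le.2 ?_)
    rintro _ ⟨u, rfl⟩
    have := P.smul_mem (2⁻¹ * τ u : F) (P.sub_mem (hZ u).1 (hZ u).2)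
    change ((0 : D), MulOpposite.op (X u)) ∈ P
    convert this using 1
    have hτ : τ u * τ u = 1 := by rcases hq.1 u u.2 with h | h <;> simp [h]
    refine Prod.ext (by simp) ?_
    simp only [Prod.smul_snd, Prod.snd_sub, ← MulOpposite.op_sub,
      ← MulOpposite.op_smul, ← sub_smul, smul_smul]
    have e : 2⁻¹ * τ u * (τ u - -τ u) = 1 := by
      field_simp
      linear_combination 2 * hτ
    rw [e, one_smul]
  rintro ⟨x, y⟩ -
  have h₁ : ((x, 0) : D × Dᵐᵒᵖ) ∈ P := hl (Submodule.mem_top (x := x))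
  have h₂ : ((0, y) : D × Dᵐᵒᵖ) ∈ P := hr (Submodule.mem_top (x := y.unop))
  simpa using P.add_mem h₁ h₂

lemma linearIndependent_exBasis (hchar : ringChar F ≠ 2) (hD : IsDinv F G D φ₀ Dgr X T β τ)
    (hto : t * t = 1) (hq : QuadData F G T β τ) :
    LinearIndependent F
      (fun s : (T ⊔ Subgroup.zpowers t : Subgroup G) => exBasis T t τ X s) := by
  have h2 : (2 : F) ≠ 0 := Ring.two_ne_zero hchar
  let p (s : (T ⊔ Subgroup.zpowers t : Subgroup G)) : T := ⟨projT G T t s, projT_mem hto s.2⟩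
  let f (s : (T ⊔ Subgroup.zpowers t : Subgroup G)) : Module.Dual F (D × Dᵐᵒᵖ) :=
    (2⁻¹ : F) • ((hD.basis.coord (p s)).comp (LinearMap.fst F D Dᵐᵒᵖ) +
      tauExt F G T t τ s • ((hD.basis.coord (p s)).comp
        ((MulOpposite.opLinearEquiv F).symm.toLinearMap)).comp (LinearMap.snd F D Dᵐᵒᵖ))
  have hf (s s' : (T ⊔ Subgroup.zpowers t : Subgroup G)) : f s (exBasis T t τ X s') =
      2⁻¹ * ((if p s' = p s then 1 else 0) * (1 + tauExt F G T t τ s * tauExt F G T t τ s')) := by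
    have : X (projT G T t s') = hD.basis (p s') := (hD.basis_apply (p s')).symm
    simp only [f, exBasis, this]
    simp [Finsupp.single_apply]
    split_ifs <;> ring
  refine LinearIndependent.of_pairwise_dual_eq_zero_one _ f (fun s s' hne => ?_) fun s => ?_
  · change f s (exBasis T t τ X s') = 0
    rw [hf]
    split_ifs with h
    · have h : projT G T t s' = projT G T t s := congrArg Subtype.val h
      have hne : (s : G) ≠ s' := fun h => hne (Subtype.ext h)
      have hτ (u : G) (hu : u ∈ T) : τ u * τ u = 1 := by
        rcases hq.1 u hu with h | h <;> simp [h]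
      have hp := projT_mem hto s.2
      by_cases h₁ : (s : G) ∈ T <;> by_cases h₂ : (s' : G) ∈ T
      · rw [projT_of_mem h₁, projT_of_mem h₂] at h
        exact absurd h.symm hne
      · rw [projT_of_mem h₁] at h hp
        rw [projT_of_notMem h₂] at h
        rw [tauExt_of_mem_s17 h₁, tauExt_of_notMem_s17 h₂, h]
        linear_combination -2⁻¹ * hτ _ hp
      · rw [projT_of_notMem h₁] at h hp
        rw [projT_of_mem h₂] at h
        rw [tauExt_of_notMem_s17 h₁, tauExt_of_mem_s17 h₂, h]
        linear_combination -2⁻¹ * hτ _ hp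
      · rw [projT_of_notMem h₁, projT_of_notMem h₂] at h
        exact absurd (mul_right_cancel h).symm hne
    · ring
  · rw [hf, if_pos rfl, tauExt_mul_self hto hq s.2]
    field_simp
    norm_num

end

/-- Every character of `T` is of the form `β(r, ·)`. -/
lemma QuadData.exists_eq_bichar [IsAlgClosed F] (hchar : ringChar F ≠ 2) [Finite T]
    (hT : ∀ s ∈ T, s * s = 1) (hq : QuadData F G T β τ) (χ : T →* F) :
    ∃ r ∈ T, ∀ u : T, β r u = χ u := by
  have h1 (u : T) : β u 1 = 1 := by
    rw [hq.2.1 _ u.2 _ T.one_mem, mul_one, hq.apply_one, mul_one]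
    rcases hq.1 _ u.2 with h | h <;> simp [h]
  obtain ⟨r, hr⟩ := exists_eq_bichar_of_nondegenerate hchar
    (fun s : T => Subtype.ext (hT s s.2))
    (fun u => { toFun := fun v => β u v
                map_one' := h1 u
                map_mul' := fun v w => hq.2.2.2.1 u u.2 v v.2 w w.2 })
    (fun u v w => hq.2.2.1 u u.2 v v.2 w w.2)
    (fun u h => Subtype.ext (hq.2.2.2.2.2 u u.2 fun v hv => h ⟨v, hv⟩)) χ
  exact ⟨r, r.2, hr⟩

end extension

section isomorphism

variable {F : Type u} [Field F] {G : Type v} [CommGroup G] [DecidableEq G]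
  {T₁ T₂ : Subgroup G} {β₁ β₂ : G → G → F} {τ₁ τ₂ : G → F}
  {D₁ : Type w} [Ring D₁] [Algebra F D₁] {φ₁ : D₁ →ₗ[F] D₁} {Dgr₁ : G → Submodule F D₁}
  {X₁ : G → D₁}
  {D₂ : Type w} [Ring D₂] [Algebra F D₂] {φ₂ : D₂ →ₗ[F] D₂} {Dgr₂ : G → Submodule F D₂}
  {X₂ : G → D₂}

lemma IsDinv.nontrivial (hD : IsDinv F G D₁ φ₁ Dgr₁ X₁ T₁ β₁ τ₁) : Nontrivial D₁ :=
  ⟨X₁ 1, 0, (hD.2.2.2.2.2.2.1 1 T₁.one_mem).1⟩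

lemma exGrT_ne_bot_iff {t : G} (hD : IsDinv F G D₁ φ₁ Dgr₁ X₁ T₁ β₁ τ₁) (ht : t ∉ T₁)
    (hto : t * t = 1) (hq : QuadData F G T₁ β₁ τ₁) (s : G) :
    exGrT F G φ₁ Dgr₁ t s ≠ ⊥ ↔ s ∈ T₁ ⊔ Subgroup.zpowers t := by
  have := hD.nontrivial
  refine ⟨fun h => by_contra fun hs => h (exGrT_eq_bot hD hto hs), fun hs => ?_⟩
  rw [exGrT_eq_span hD ht hto hs, Ne, Submodule.span_singleton_eq_bot]
  exact (isUnit_exBasis hD hto hq hs).ne_zero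

/-- A graded isomorphism of twisted exchange doubles determines the support, the twisting element
and the commutation factor. -/
lemma data_eq_of_gradedEquiv {t₁ t₂ : G} (ht₁ : t₁ ∉ T₁) (ht₂ : t₂ ∉ T₂)
    (ht₁o : t₁ * t₁ = 1) (ht₁1 : t₁ ≠ 1) (ht₂o : t₂ * t₂ = 1)
    (hq₁ : QuadData F G T₁ β₁ τ₁) (hq₂ : QuadData F G T₂ β₂ τ₂)
    (hD₁ : IsDinv F G D₁ φ₁ Dgr₁ X₁ T₁ β₁ τ₁) (hD₂ : IsDinv F G D₂ φ₂ Dgr₂ X₂ T₂ β₂ τ₂)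
    (e : (D₁ × D₁ᵐᵒᵖ) ≃ₐ[F] (D₂ × D₂ᵐᵒᵖ))
    (hgr : ∀ h : G, Submodule.map (e : (D₁ × D₁ᵐᵒᵖ) →ₗ[F] (D₂ × D₂ᵐᵒᵖ))
      (exGrT F G φ₁ Dgr₁ t₁ h) = exGrT F G φ₂ Dgr₂ t₂ h) :
    T₁ ⊔ Subgroup.zpowers t₁ = T₂ ⊔ Subgroup.zpowers t₂ ∧ t₁ = t₂ ∧
      ∀ s ∈ T₁ ⊔ Subgroup.zpowers t₁, ∀ s' ∈ T₁ ⊔ Subgroup.zpowers t₁,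
        betaExt F G T₁ t₁ β₁ s s' = betaExt F G T₂ t₂ β₂ s s' := by
  have := hD₂.nontrivial
  have hsup : T₁ ⊔ Subgroup.zpowers t₁ = T₂ ⊔ Subgroup.zpowers t₂ := by
    ext s
    rw [← exGrT_ne_bot_iff hD₁ ht₁ ht₁o hq₁, ← exGrT_ne_bot_iff hD₂ ht₂ ht₂o hq₂, ← hgr]
    exact not_congr (((Submodule.map_injective_of_injective e.injective).eq_iff'
      (Submodule.map_bot _)).symm)
  have hβ : ∀ s ∈ T₁ ⊔ Subgroup.zpowers t₁, ∀ s' ∈ T₁ ⊔ Subgroup.zpowers t₁,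
      betaExt F G T₁ t₁ β₁ s s' = betaExt F G T₂ t₂ β₂ s s' := by
    have himg (s : G) (hs : s ∈ T₁ ⊔ Subgroup.zpowers t₁) :
        ∃ c : F, c • exBasis T₂ t₂ τ₂ X₂ s = e (exBasis T₁ t₁ τ₁ X₁ s) := by
      rw [← Submodule.mem_span_singleton, ← exGrT_eq_span hD₂ ht₂ ht₂o (hsup ▸ hs), ← hgr,
        exGrT_eq_span hD₁ ht₁ ht₁o hs]
      exact ⟨_, Submodule.mem_span_singleton_self _, rfl⟩
    intro s hs s' hs'
    obtain ⟨c, hc⟩ := himg s hs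
    obtain ⟨c', hc'⟩ := himg s' hs'
    have h₁ := congrArg e (exBasis_comm hD₁ ht₁o hq₁ hs hs')
    have h₂ : e (exBasis T₁ t₁ τ₁ X₁ s) * e (exBasis T₁ t₁ τ₁ X₁ s') =
        betaExt F G T₂ t₂ β₂ s s' •
          (e (exBasis T₁ t₁ τ₁ X₁ s') * e (exBasis T₁ t₁ τ₁ X₁ s)) := by
      rw [← hc, ← hc', smul_mul_smul_comm, smul_mul_smul_comm,
        exBasis_comm hD₂ ht₂o hq₂ (hsup ▸ hs) (hsup ▸ hs'), smul_comm, mul_comm c]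
    rw [map_smul, map_mul, map_mul, h₂] at h₁
    have hu := (((isUnit_exBasis hD₁ ht₁o hq₁ hs').map e).mul
      ((isUnit_exBasis hD₁ ht₁o hq₁ hs).map e)).ne_zero
    exact (smul_left_injective F hu h₁).symm
  have ht : t₁ ∈ T₁ ⊔ Subgroup.zpowers t₁ := Subgroup.mem_sup_right (Subgroup.mem_zpowers t₁)
  refine ⟨hsup, (betaExt_radical ht₂o hq₂ (hsup ▸ ht) fun s hs => ?_).resolve_left ht₁1, hβ⟩
  rw [← hsup] at hs
  rw [← hβ _ ht _ hs, betaExt_self_left ht₁ ht₁o hq₁ hs]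

/-- If supports, twisting elements and commutation factors agree, then some homogeneous twist of
the first involution makes the two doubles isomorphic. -/
lemma exists_gradedEquiv_of_data_eq [IsAlgClosed F] (hchar : ringChar F ≠ 2) {t : G}
    (hT₁2 : ∀ s ∈ T₁, s * s = 1) (ht₁ : t ∉ T₁) (ht₂ : t ∉ T₂) (hto : t * t = 1)
    (hq₁ : QuadData F G T₁ β₁ τ₁) (hq₂ : QuadData F G T₂ β₂ τ₂)
    (hD₁ : IsDinv F G D₁ φ₁ Dgr₁ X₁ T₁ β₁ τ₁) (hD₂ : IsDinv F G D₂ φ₂ Dgr₂ X₂ T₂ β₂ τ₂)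
    (hsup : T₁ ⊔ Subgroup.zpowers t = T₂ ⊔ Subgroup.zpowers t)
    (hβ : ∀ s ∈ T₁ ⊔ Subgroup.zpowers t, ∀ s' ∈ T₁ ⊔ Subgroup.zpowers t,
      betaExt F G T₁ t β₁ s s' = betaExt F G T₂ t β₂ s s') :
    ∃ d : (D₁ × D₁ᵐᵒᵖ)ˣ, ∃ h₀ : G, (d : D₁ × D₁ᵐᵒᵖ) ∈ exGrT F G φ₁ Dgr₁ t h₀ ∧
      ∃ e : (D₁ × D₁ᵐᵒᵖ) ≃ₐ[F] (D₂ × D₂ᵐᵒᵖ),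
        (∀ x : D₁ × D₁ᵐᵒᵖ,
          e ((d : D₁ × D₁ᵐᵒᵖ) * exInvG F D₁ x * ((d⁻¹ : (D₁ × D₁ᵐᵒᵖ)ˣ) : D₁ × D₁ᵐᵒᵖ))
            = exInvG F D₂ (e x)) ∧
        (∀ h : G,
          Submodule.map (e : (D₁ × D₁ᵐᵒᵖ) →ₗ[F] (D₂ × D₂ᵐᵒᵖ)) (exGrT F G φ₁ Dgr₁ t h)
            = exGrT F G φ₂ Dgr₂ t h) := by
  have : FiniteDimensional F D₁ := hD₁.2.2.2.1
  have : FiniteDimensional F D₂ := hD₂.2.2.2.1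
  have : Finite T₁ := Module.Finite.finite_basis hD₁.basis
  have hS₂ (s : (T₁ ⊔ Subgroup.zpowers t : Subgroup G)) : (s : G) ∈ T₂ ⊔ Subgroup.zpowers t :=
    hsup ▸ s.2
  -- the graded isomorphism
  have hli := linearIndependent_exBasis hchar hD₂ hto hq₂
  have hsp := span_exBasis hchar hD₂ ht₂ hto hq₂
  rw [← hsup] at hli hsp
  let Z₁ := Module.Basis.mk (linearIndependent_exBasis hchar hD₁ hto hq₁)
    (span_exBasis hchar hD₁ ht₁ hto hq₁)
  let Z₂ := Module.Basis.mk hli hsp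
  have hZ₁ (s : (T₁ ⊔ Subgroup.zpowers t : Subgroup G)) : Z₁ s = exBasis T₁ t τ₁ X₁ s := by
    simp [Z₁]
  have hZ₂ (s : (T₁ ⊔ Subgroup.zpowers t : Subgroup G)) : Z₂ s = exBasis T₂ t τ₂ X₂ s := by
    simp [Z₂]
  obtain ⟨e, c, hc, he⟩ := exists_algEquiv_of_twisted Z₁ Z₂
    (fun s => hZ₁ s ▸ isUnit_exBasis hD₁ hto hq₁ s.2)
    (fun s => hZ₂ s ▸ isUnit_exBasis hD₂ hto hq₂ (hS₂ s))
    (fun s s' => by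
      simpa only [hZ₁, Subgroup.coe_mul] using exBasis_mul hD₁ hto hq₁ s.2 s'.2)
    (fun s s' => by
      simpa only [hZ₂, Subgroup.coe_mul] using exBasis_mul hD₂ hto hq₂ (hS₂ s) (hS₂ s'))
    (fun s s' => betaExt F G T₁ t β₁ s s')
    (fun s s' => by simpa only [hZ₁] using exBasis_comm hD₁ hto hq₁ s.2 s'.2)
    (fun s s' => by
      simpa only [hZ₂, hβ s s.2 s' s'.2] using exBasis_comm hD₂ hto hq₂ (hS₂ s) (hS₂ s'))
  let χ (s : G) : F := tauExt F G T₁ t τ₁ s * tauExt F G T₂ t τ₂ s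
  have hχ {s s' : G} (hs : s ∈ T₁ ⊔ Subgroup.zpowers t) (hs' : s' ∈ T₁ ⊔ Subgroup.zpowers t) :
      χ (s * s') = χ s * χ s' := by
    have h₁ := (projT_mul_and_polar hto hq₁ hs hs').2
    have h₂ := (projT_mul_and_polar hto hq₂ (hsup ▸ hs) (hsup ▸ hs')).2
    have hb := hβ s hs s' hs'
    rw [h₁, h₂] at hb
    have q₂ := tauExt_mul_self hto hq₁ hs
    have q₃ := tauExt_mul_self hto hq₁ hs'
    have q₆ := tauExt_mul_self hto hq₂
      (hsup ▸ mul_mem hs hs' : s * s' ∈ T₂ ⊔ Subgroup.zpowers t)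
    simp only [χ]
    generalize tauExt F G T₁ t τ₁ (s * s') = a at *
    generalize tauExt F G T₁ t τ₁ s = a' at *
    generalize tauExt F G T₁ t τ₁ s' = a'' at *
    generalize tauExt F G T₂ t τ₂ (s * s') = b at *
    generalize tauExt F G T₂ t τ₂ s = b' at *
    generalize tauExt F G T₂ t τ₂ s' = b'' at *
    calc a * b = a * b * (a' * a') * (a'' * a'') := by rw [q₂, q₃]; ring
      _ = (a * a' * a'') * (b * a' * a'') := by ring
      _ = (b * b) * (a' * b' * (a'' * b'')) := by rw [hb]; ring
      _ = a' * b' * (a'' * b'') := by rw [q₆, one_mul]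
  have hχ1 : χ 1 = 1 := by
    simp only [χ]
    rw [tauExt_of_mem_s17 T₁.one_mem, tauExt_of_mem_s17 T₂.one_mem, hq₁.apply_one, hq₂.apply_one, one_mul]
  have hχt : χ t = 1 := by
    simp only [χ]
    rw [tauExt_self ht₁ hto hq₁, tauExt_self ht₂ hto hq₂, neg_mul_neg, one_mul]
  have htS : t ∈ T₁ ⊔ Subgroup.zpowers t := Subgroup.mem_sup_right (Subgroup.mem_zpowers t)
  obtain ⟨r, hr, hrχ⟩ := hq₁.exists_eq_bichar hchar hT₁2
    { toFun := fun u : T₁ => χ u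
      map_one' := hχ1
      map_mul' := fun u v => hχ (Subgroup.mem_sup_left u.2) (Subgroup.mem_sup_left v.2) }
  have hrS : r ∈ T₁ ⊔ Subgroup.zpowers t := Subgroup.mem_sup_left hr
  have hrβ {s : G} (hs : s ∈ T₁ ⊔ Subgroup.zpowers t) : betaExt F G T₁ t β₁ r s = χ s := by
    rw [betaExt, projT_of_mem hr]
    refine (hrχ ⟨_, projT_mem hto hs⟩).trans ?_
    change χ (projT G T₁ t s) = χ s
    by_cases h : s ∈ T₁
    · rw [projT_of_mem h]
    · rw [projT_of_notMem h, hχ hs htS, hχt, mul_one]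
  have hu := isUnit_exBasis hD₁ hto hq₁ hrS
  refine ⟨hu.unit, r, ?_, e, ?_, fun h => ?_⟩
  · rw [exGrT_eq_span hD₁ ht₁ hto hrS]
    exact Submodule.mem_span_singleton_self _
  · let d := hu.unit
    have hlin : e.toLinearMap ∘ₗ (LinearMap.mulRight F ((d⁻¹ : (D₁ × D₁ᵐᵒᵖ)ˣ) : D₁ × D₁ᵐᵒᵖ)) ∘ₗ
        (LinearMap.mulLeft F (d : D₁ × D₁ᵐᵒᵖ)) ∘ₗ exInvG F D₁ =
        exInvG F D₂ ∘ₗ e.toLinearMap := by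
      refine Z₁.ext fun s => ?_
      change e ((d : D₁ × D₁ᵐᵒᵖ) * exInvG F D₁ (Z₁ s) *
        ((d⁻¹ : (D₁ × D₁ᵐᵒᵖ)ˣ) : D₁ × D₁ᵐᵒᵖ)) = exInvG F D₂ (e (Z₁ s))
      have hd : (d : D₁ × D₁ᵐᵒᵖ) * exBasis T₁ t τ₁ X₁ s =
          χ s • (exBasis T₁ t τ₁ X₁ s * (d : D₁ × D₁ᵐᵒᵖ)) := by
        rw [← hrβ s.2]
        exact exBasis_comm hD₁ hto hq₁ hrS s.2
      have h₁ : (d : D₁ × D₁ᵐᵒᵖ) * exInvG F D₁ (Z₁ s) *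
          ((d⁻¹ : (D₁ × D₁ᵐᵒᵖ)ˣ) : D₁ × D₁ᵐᵒᵖ) = tauExt F G T₂ t τ₂ s • Z₁ s := by
        rw [hZ₁, exInvG_exBasis hto hq₁ s.2, mul_smul_comm, hd, smul_smul, smul_mul_assoc,
          Units.mul_inv_cancel_right, ← mul_assoc, tauExt_mul_self hto hq₁ s.2, one_mul]
      rw [h₁, map_smul, he, map_smul, hZ₂, exInvG_exBasis hto hq₂ (hS₂ s), smul_comm]
    exact fun x => LinearMap.congr_fun hlin x
  · by_cases hh : h ∈ T₁ ⊔ Subgroup.zpowers t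
    · have := he ⟨h, hh⟩
      rw [hZ₁, hZ₂] at this
      rw [exGrT_eq_span hD₁ ht₁ hto hh, exGrT_eq_span hD₂ ht₂ hto (hsup ▸ hh),
        Submodule.map_span, Set.image_singleton]
      change Submodule.span F {e (exBasis T₁ t τ₁ X₁ h)} = _
      rw [this, Submodule.span_singleton_smul_eq (hc ⟨h, hh⟩).isUnit]
    · rw [exGrT_eq_bot hD₁ hto hh, exGrT_eq_bot hD₂ hto (hsup ▸ hh), Submodule.map_bot]

end isomorphism

/-!
STATEMENT 17.  Let T₁, T₂ ≤ G be elementary 2-subgroups, tᵢ ∈ G∖Tᵢ of order 2, and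
τᵢ : Tᵢ → F quadratic forms with nondegenerate alternating polar forms βᵢ.  Then there is a
homogeneous element d of D_inv(T₁,β₁,τ₁)^ex_{t₁} with
D_inv(T₁,β₁,τ₁,d)^ex_{t₁} ≅ D_inv(T₂,β₂,τ₂)^ex_{t₂}  iff  T₁⟨t₁⟩ = T₂⟨t₂⟩, t₁ = t₂ and
β₁^[t₁] = β₂^[t₂]  (F algebraically closed, char F ≠ 2).
-/

theorem stmt_17
    (F : Type u) [Field F] [IsAlgClosed F] (hchar : ringChar F ≠ 2)
    (G : Type v) [CommGroup G] [DecidableEq G]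
    -- T₁, T₂ elementary 2-subgroups, tᵢ ∉ Tᵢ of order 2
    (T₁ T₂ : Subgroup G) (hT₁2 : ∀ s ∈ T₁, s * s = 1) (hT₂2 : ∀ s ∈ T₂, s * s = 1)
    (t₁ t₂ : G) (ht₁ : t₁ ∉ T₁) (ht₂ : t₂ ∉ T₂)
    (ht₁o : t₁ * t₁ = 1) (ht₁1 : t₁ ≠ 1) (ht₂o : t₂ * t₂ = 1) (ht₂1 : t₂ ≠ 1)
    -- the quadratic forms and their polar forms
    (β₁ β₂ : G → G → F) (τ₁ τ₂ : G → F)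
    (hq₁ : QuadData F G T₁ β₁ τ₁) (hq₂ : QuadData F G T₂ β₂ τ₂)
    -- D_inv(T₁,β₁,τ₁) and D_inv(T₂,β₂,τ₂)
    (D₁ : Type w) [Ring D₁] [Algebra F D₁] (φ₁ : D₁ →ₗ[F] D₁)
    (Dgr₁ : G → Submodule F D₁) (X₁ : G → D₁)
    (hD₁ : IsDinv F G D₁ φ₁ Dgr₁ X₁ T₁ β₁ τ₁)
    (D₂ : Type w) [Ring D₂] [Algebra F D₂] (φ₂ : D₂ →ₗ[F] D₂)
    (Dgr₂ : G → Submodule F D₂) (X₂ : G → D₂)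
    (hD₂ : IsDinv F G D₂ φ₂ Dgr₂ X₂ T₂ β₂ τ₂) :
    -- ∃ d homogeneous with D_inv(T₁,β₁,τ₁,d)^ex_{t₁} ≅ D_inv(T₂,β₂,τ₂)^ex_{t₂} ...
    ((∃ d : (D₁ × D₁ᵐᵒᵖ)ˣ, ∃ h₀ : G, (d : D₁ × D₁ᵐᵒᵖ) ∈ exGrT F G φ₁ Dgr₁ t₁ h₀ ∧
        ∃ e : (D₁ × D₁ᵐᵒᵖ) ≃ₐ[F] (D₂ × D₂ᵐᵒᵖ),
          -- e intertwines the involution Int(d)∘ex with ex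
          (∀ x : D₁ × D₁ᵐᵒᵖ,
            e ((d : D₁ × D₁ᵐᵒᵖ) * exInvG F D₁ x * ((d⁻¹ : (D₁ × D₁ᵐᵒᵖ)ˣ) : D₁ × D₁ᵐᵒᵖ))
              = exInvG F D₂ (e x)) ∧
          -- e preserves the gradings
          (∀ h : G,
            Submodule.map (e : (D₁ × D₁ᵐᵒᵖ) →ₗ[F] (D₂ × D₂ᵐᵒᵖ)) (exGrT F G φ₁ Dgr₁ t₁ h)
              = exGrT F G φ₂ Dgr₂ t₂ h)) ↔
    -- ... iff T₁⟨t₁⟩ = T₂⟨t₂⟩, t₁ = t₂ and β₁^[t₁] = β₂^[t₂]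
      (T₁ ⊔ Subgroup.zpowers t₁ = T₂ ⊔ Subgroup.zpowers t₂ ∧ t₁ = t₂ ∧
        ∀ s ∈ T₁ ⊔ Subgroup.zpowers t₁, ∀ s' ∈ T₁ ⊔ Subgroup.zpowers t₁,
          betaExt F G T₁ t₁ β₁ s s' = betaExt F G T₂ t₂ β₂ s s')) := by
  constructor
  · rintro ⟨-, -, -, e, -, hgr⟩
    exact data_eq_of_gradedEquiv ht₁ ht₂ ht₁o ht₁1 ht₂o hq₁ hq₂ hD₁ hD₂ e hgr
  · rintro ⟨hsup, rfl, hβ⟩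
    exact exists_gradedEquiv_of_data_eq hchar hT₁2 ht₁ ht₂ ht₁o hq₁ hq₂ hD₁ hD₂ hsup hβ
end
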